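/- arXiv:math/0506398 — 3 statements merged into one kernel-verified Lean document; each statement's English description precedes it below -/
import Mathlib

section
/- Let (f_n)_{n≥0} be a real recurrence sequence, i.e. a real sequence satisfying a linear recurrence f_{n+h} = c_1 f_{n+h-1} + ... + c_{h-1} f_{n+1} + c_h f_n for all n ≥ 0 with constant real coefficients c_1, ..., c_h. Then the natural density of the set {n ∈ ℕ : f_n > 0} exists. -/
/-- A set `A ⊆ ℕ` has natural density `δ` if `#{n ≤ x : n ∈ A}/x → δ` as `x → ∞`. -/
def HasNatDensity (A : Set ℕ) (δ : ℝ) : Prop :=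
  Filter.Tendsto (fun x : ℕ => ((A ∩ Set.Iic x).ncard : ℝ) / x) Filter.atTop (nhds δ)

/-- A real sequence satisfying a linear recurrence with constant real coefficients. -/
def IsLinearRecurrence (f : ℕ → ℝ) : Prop :=
  ∃ h : ℕ, 0 < h ∧ ∃ c : Fin h → ℝ, ∀ n : ℕ, f (n + h) = ∑ k : Fin h, c k * f (n + k)

open Filter Topology Finset

open Classical in
/-- number of elements of `A` below `N` -/
noncomputable def cnt (A : Set ℕ) (N : ℕ) : ℕ := ((range N).filter (· ∈ A)).card

lemma cnt_mono {A B : Set ℕ} (h : A ⊆ B) (N : ℕ) : cnt A N ≤ cnt B N := by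
  classical
  unfold cnt
  apply card_le_card
  intro x hx
  simp only [mem_filter] at hx ⊢
  exact ⟨hx.1, h hx.2⟩

lemma cnt_union_le (A B : Set ℕ) (N : ℕ) : cnt (A ∪ B) N ≤ cnt A N + cnt B N := by
  classical
  unfold cnt
  refine le_trans (card_le_card ?_) (card_union_le _ _)
  intro x hx
  simp only [mem_filter, mem_union, Set.mem_union] at hx ⊢
  tauto

lemma cnt_biUnion_le (s : Finset ℕ) (A : ℕ → Set ℕ) (N : ℕ) :
    cnt (⋃ h ∈ s, A h) N ≤ ∑ h ∈ s, cnt (A h) N := by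
  classical
  induction s using Finset.induction_on with
  | empty => simp [cnt]
  | insert a s ha ih =>
    rw [Finset.sum_insert ha, Finset.set_biUnion_insert]
    exact (cnt_union_le _ _ _).trans (by gcongr)

lemma cnt_Iio_le (k N : ℕ) : cnt (Set.Iio k) N ≤ k := by
  classical
  unfold cnt
  calc _ ≤ (range k).card := by
        apply card_le_card
        intro x hx
        simp only [mem_filter, Set.mem_Iio, mem_range] at hx ⊢
        exact hx.2
    _ = k := card_range k

lemma cnt_sparse (A : Set ℕ) (H : ℕ) (hH : 0 < H)
    (hA : ∀ x ∈ A, ∀ h, 0 < h → h < H → x + h ∉ A) (N : ℕ) : cnt A N ≤ N / H + 1 := by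
  classical
  unfold cnt
  rw [← card_range (N / H + 1)]
  apply card_le_card_of_injOn (fun x => x / H)
  · intro x hx
    simp only [coe_filter, mem_range, Set.mem_ofPred_eq, coe_range, Set.mem_Iio] at hx ⊢
    have := Nat.div_le_div_right (c := H) hx.1.le
    omega
  · have key : ∀ x ∈ A, ∀ y ∈ A, x / H = y / H → ¬ x < y := by
      intro x hx y hy hxy hlt
      have h1 := Nat.div_add_mod x H
      have h2 := Nat.div_add_mod y H
      have h3 := Nat.mod_lt x hH
      have h4 := Nat.mod_lt y hH
      rw [hxy] at h1
      apply hA x hx (y - x) (by omega) (by omega)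
      rwa [Nat.add_sub_cancel' hlt.le]
    intro x hx y hy hxy
    simp only [coe_filter, mem_range, Set.mem_ofPred_eq] at hx hy hxy
    have a := key x hx.2 y hy.2 hxy
    have b := key y hy.2 x hx.2 hxy.symm
    omega

lemma anticonc (S : Finset ℂ) (hS : S.Nonempty) (hn : ∀ z ∈ S, ‖z‖ = 1)
    (hnd : ∀ z ∈ S, ∀ w ∈ S, ∀ m : ℕ, 0 < m → z ^ m = w ^ m → z = w) :
    ∀ c : ℂ → ℂ, (∀ z ∈ S, c z ≠ 0) → ∀ δ : ℝ, 0 < δ → ∃ ε : ℝ, 0 < ε ∧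
      ∀ᶠ N : ℕ in atTop, (cnt {n | ‖∑ z ∈ S, c z * z ^ n‖ < ε} N : ℝ) ≤ δ * N := by
  classical
  induction hS using Finset.Nonempty.cons_induction with
  | singleton a =>
    intro c hc δ hδ
    refine ⟨‖c a‖, by simpa using hc a (by simp), ?_⟩
    refine Eventually.of_forall fun N => ?_
    have : {n : ℕ | ‖∑ z ∈ {a}, c z * z ^ n‖ < ‖c a‖} = ∅ := by
      ext n; simp [hn a (by simp)]
    rw [this]
    simp only [cnt, Set.mem_empty_iff_false, filter_false, card_empty, Nat.cast_zero]
    positivity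
  | cons a S ha hS ih =>
    intro c hc δ hδ
    have ih' := ih (fun z hz => hn z (by simp [hz]))
      (fun z hz w hw => hnd z (by simp [hz]) w (by simp [hw]))
    obtain ⟨H, hH⟩ := exists_nat_gt (3 / δ)
    have hHpos : (0 : ℝ) < H := lt_trans (by positivity) hH
    have hH0 : 0 < H := by exact_mod_cast hHpos
    have step : ∀ h : ℕ, ∃ ε : ℝ, 0 < ε ∧ (0 < h → ∀ᶠ N : ℕ in atTop,
        (cnt {n | ‖∑ z ∈ S, (c z * (z ^ h - a ^ h)) * z ^ n‖ < ε} N : ℝ) ≤ δ / (3 * H) * N) := by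
      intro h
      by_cases hh : 0 < h
      · obtain ⟨ε, h1, h2⟩ := ih' (fun z => c z * (z ^ h - a ^ h)) (by
          intro z hz
          refine mul_ne_zero (hc z (by simp [hz])) ?_
          intro h0
          have := hnd z (by simp [hz]) a (by simp) h hh (sub_eq_zero.mp h0)
          exact ha (this ▸ hz)) (δ / (3 * H)) (by positivity)
        exact ⟨ε, h1, fun _ => h2⟩
      · exact ⟨1, one_pos, fun h' => absurd h' hh⟩
    choose e he0 he using step
    obtain ⟨ε, hε, hε0⟩ : ∃ ε : ℝ, (∀ h ∈ Finset.Ico 1 H, 2 * ε ≤ e h) ∧ 0 < ε := by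
      have h1 : ∀ᶠ ε : ℝ in 𝓝[>] 0, ∀ h ∈ Finset.Ico 1 H, 2 * ε ≤ e h := by
        rw [Filter.eventually_all_finset]
        intro h _
        have : Set.Iio (e h / 2) ∈ 𝓝 (0 : ℝ) := Iio_mem_nhds (by have := he0 h; positivity)
        filter_upwards [mem_nhdsWithin_of_mem_nhds this] with x hx
        have : x < e h / 2 := hx
        linarith
      exact (h1.and self_mem_nhdsWithin).exists
    refine ⟨ε, hε0, ?_⟩
    set g : ℕ → ℂ := fun n => ∑ z ∈ cons a S ha, c z * z ^ n with hg
    set A : Set ℕ := {n | ‖g n‖ < ε} with hA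
    set B : ℕ → Set ℕ := fun h => {n | ‖∑ z ∈ S, (c z * (z ^ h - a ^ h)) * z ^ n‖ < e h} with hB
    have hev : ∀ᶠ N : ℕ in atTop, ∀ h ∈ Finset.Ico 1 H, (cnt (B h) N : ℝ) ≤ δ / (3 * H) * N := by
      rw [Filter.eventually_all_finset]
      intro h hh
      exact he h (by simp at hh; omega)
    have hdiff : ∀ h n, g (n + h) - a ^ h * g n = ∑ z ∈ S, (c z * (z ^ h - a ^ h)) * z ^ n := by
      intro h n
      simp only [hg, Finset.sum_cons, mul_add, Finset.mul_sum]
      have : ∀ x y z w : ℂ, x = z → (x + y) - (z + w) = y - w := by intros; subst_vars; ring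
      rw [this _ _ _ _ (by ring), ← Finset.sum_sub_distrib]
      exact Finset.sum_congr rfl fun z _ => by ring
    have hsub : A ⊆ (⋃ h ∈ Finset.Ico 1 H, B h) ∪
        {x | x ∈ A ∧ ∀ h, 0 < h → h < H → x + h ∉ A} := by
      intro x hx
      by_cases hc : ∀ h, 0 < h → h < H → x + h ∉ A
      · exact Or.inr ⟨hx, hc⟩
      · left
        push Not at hc
        obtain ⟨h, h0, h1, h2⟩ := hc
        simp only [Set.mem_iUnion]
        refine ⟨h, by simp; omega, ?_⟩
        simp only [hB, Set.mem_ofPred_eq]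
        rw [← hdiff]
        have h3 : ‖g (x + h)‖ < ε := h2
        have h4 : ‖g x‖ < ε := hx
        calc _ ≤ ‖g (x + h)‖ + ‖a ^ h * g x‖ := norm_sub_le _ _
          _ = ‖g (x + h)‖ + ‖g x‖ := by rw [norm_mul, norm_pow, hn a (by simp), one_pow, one_mul]
          _ < 2 * ε := by linarith
          _ ≤ e h := hε h (by simp; omega)
    have hNlarge : ∀ᶠ N : ℕ in atTop, 3 / δ ≤ (N : ℝ) :=
      tendsto_natCast_atTop_atTop.eventually_ge_atTop _
    filter_upwards [hev, hNlarge] with N h1 h2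
    have c1 : cnt A N ≤ (∑ h ∈ Finset.Ico 1 H, cnt (B h) N) + (N / H + 1) := by
      refine (cnt_mono hsub N).trans ((cnt_union_le _ _ _).trans ?_)
      gcongr
      · exact cnt_biUnion_le _ _ _
      · apply cnt_sparse _ H hH0
        rintro x ⟨_, hx⟩ h h0 h1 h2
        exact hx h h0 h1 h2.1
    have c2 : (cnt A N : ℝ) ≤ (∑ h ∈ Finset.Ico 1 H, (cnt (B h) N : ℝ)) + ((N / H : ℕ) + 1) := by
      exact_mod_cast c1
    have c3 : ∑ h ∈ Finset.Ico 1 H, (cnt (B h) N : ℝ) ≤ H * (δ / (3 * H) * N) := by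
      refine (Finset.sum_le_sum h1).trans ?_
      rw [Finset.sum_const, nsmul_eq_mul]
      gcongr
      simp
    have c4 : H * (δ / (3 * H) * N) = δ / 3 * N := by field_simp
    have c5 : ((N / H : ℕ) : ℝ) ≤ N / H := Nat.cast_div_le
    have c6 : (N : ℝ) / H ≤ δ / 3 * N := by
      rw [div_le_iff₀ hHpos]
      rw [div_lt_iff₀ hδ] at hH
      nlinarith [Nat.cast_nonneg (α := ℝ) N]
    have c7 : 1 ≤ δ / 3 * N := by
      rw [div_le_iff₀ hδ] at h2; linarith
    linarith

/-- the Cesàro means of `v` converge -/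
def HasMean {E : Type*} [NormedAddCommGroup E] [NormedSpace ℝ E] (v : ℕ → E) : Prop :=
  ∃ m : E, Tendsto (fun N : ℕ => (N : ℝ)⁻¹ • ∑ n ∈ range N, v n) atTop (𝓝 m)

section
variable {E : Type*} [NormedAddCommGroup E] [NormedSpace ℝ E]

lemma HasMean.add {v w : ℕ → E} (hv : HasMean v) (hw : HasMean w) :
    HasMean (fun n => v n + w n) := by
  obtain ⟨m, hm⟩ := hv
  obtain ⟨k, hk⟩ := hw
  refine ⟨m + k, (hm.add hk).congr fun N => ?_⟩
  rw [Finset.sum_add_distrib, smul_add]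

lemma HasMean.of_tendsto {v : ℕ → E} {l : E} (hv : Tendsto v atTop (𝓝 l)) : HasMean v :=
  ⟨l, hv.cesaro_smul⟩

lemma HasMean.sum {ι : Type*} (s : Finset ι) {v : ι → ℕ → E} (hv : ∀ i ∈ s, HasMean (v i)) :
    HasMean (fun n => ∑ i ∈ s, v i n) := by
  classical
  induction s using Finset.induction_on with
  | empty => simpa using HasMean.of_tendsto (tendsto_const_nhds (x := (0 : E)))
  | insert a s ha ih =>
    simp only [Finset.sum_insert ha]
    exact (hv a (by simp)).add (ih fun i hi => hv i (by simp [hi]))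
end

lemma HasMean.const_mul {v : ℕ → ℂ} (hv : HasMean v) (c : ℂ) : HasMean (fun n => c * v n) := by
  obtain ⟨m, hm⟩ := hv
  refine ⟨c * m, (hm.const_mul c).congr fun N => ?_⟩
  rw [← Finset.mul_sum, mul_smul_comm]

lemma HasMean.const_mul_real {v : ℕ → ℝ} (hv : HasMean v) (c : ℝ) :
    HasMean (fun n => c * v n) := by
  obtain ⟨m, hm⟩ := hv
  refine ⟨c * m, (hm.const_mul c).congr fun N => ?_⟩
  rw [← Finset.mul_sum, mul_smul_comm]

lemma HasMean.geom {z : ℂ} (hz : ‖z‖ = 1) : HasMean (fun n => z ^ n) := by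
  by_cases h1 : z = 1
  · subst h1
    simpa using HasMean.of_tendsto (tendsto_const_nhds (x := (1 : ℂ)))
  · refine ⟨0, ?_⟩
    refine squeeze_zero_norm (a := fun N : ℕ => (N : ℝ)⁻¹ * (2 / ‖z - 1‖)) ?_ ?_
    · intro N
      rw [norm_smul, norm_inv, Real.norm_natCast, geom_sum_eq h1, norm_div]
      gcongr
      calc _ ≤ ‖z ^ N‖ + ‖(1 : ℂ)‖ := norm_sub_le _ _
        _ = 2 := by rw [norm_pow, hz]; norm_num
    · simpa using (tendsto_inv_atTop_nhds_zero_nat (𝕜 := ℝ)).mul_const (2 / ‖z - 1‖)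

lemma moments (S : Finset ℂ) (hn : ∀ z ∈ S, ‖z‖ = 1) (c : ℂ → ℂ) (u : ℕ → ℂ) (B : ℝ)
    (hB : ∀ n, ‖u n‖ ≤ B)
    (hu : Tendsto (fun n => u n - ∑ z ∈ S, c z * z ^ n) atTop (𝓝 0)) (k : ℕ) :
    ∀ μ : ℂ, ‖μ‖ = 1 → HasMean (fun n => μ ^ n * u n ^ k) := by
  induction k with
  | zero => intro μ hμ; simpa using HasMean.geom hμ
  | succ k ih =>
    intro μ hμ
    have h1 : HasMean (fun n => ∑ z ∈ S, c z * ((μ * z) ^ n * u n ^ k)) :=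
      HasMean.sum S fun z hz => (ih (μ * z) (by rw [norm_mul, hμ, hn z hz, one_mul])).const_mul _
    have h2 : Tendsto (fun n => (μ ^ n * u n ^ k) * (u n - ∑ z ∈ S, c z * z ^ n)) atTop (𝓝 0) := by
      refine squeeze_zero_norm (a := fun n => B ^ k * ‖u n - ∑ z ∈ S, c z * z ^ n‖) ?_ ?_
      · intro n
        rw [norm_mul, norm_mul, norm_pow, norm_pow, hμ, one_pow, one_mul]
        gcongr
        exact hB n
      · simpa using hu.norm.const_mul (B ^ k)
    convert h1.add (HasMean.of_tendsto h2) using 2 with n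
    have : ∑ z ∈ S, c z * ((μ * z) ^ n * u n ^ k) = (μ ^ n * u n ^ k) * ∑ z ∈ S, c z * z ^ n := by
      rw [Finset.mul_sum]
      exact Finset.sum_congr rfl fun z _ => by rw [mul_pow]; ring
    rw [this]; ring

lemma HasMean.re {v : ℕ → ℝ} (hv : HasMean (fun n => (v n : ℂ))) : HasMean v := by
  obtain ⟨m, hm⟩ := hv
  refine ⟨m.re, ((Complex.continuous_re.tendsto m).comp hm).congr fun N => ?_⟩
  simp

lemma poly_mean (u : ℕ → ℝ) (h : ∀ k : ℕ, HasMean (fun n => u n ^ k)) (p : Polynomial ℝ) :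
    HasMean (fun n => p.eval (u n)) := by
  simp only [Polynomial.eval_eq_sum_range]
  exact HasMean.sum _ fun i _ => (h i).const_mul_real _

lemma tendsto_of_approx (d : ℕ → ℝ)
    (h : ∀ δ > 0, ∃ e : ℕ → ℝ, (∃ m, Tendsto e atTop (𝓝 m)) ∧ ∀ᶠ N in atTop, |d N - e N| ≤ δ) :
    ∃ m, Tendsto d atTop (𝓝 m) := by
  apply cauchySeq_tendsto_of_complete
  rw [Metric.cauchySeq_iff]
  intro ε hε
  obtain ⟨e, ⟨m, hm⟩, he⟩ := h (ε / 4) (by positivity)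
  have hc := hm.cauchySeq
  rw [Metric.cauchySeq_iff] at hc
  obtain ⟨N1, hN1⟩ := hc (ε / 4) (by positivity)
  obtain ⟨N2, hN2⟩ := eventually_atTop.1 he
  refine ⟨max N1 N2, fun a ha b hb => ?_⟩
  have h1 := hN1 a (le_trans (le_max_left _ _) ha) b (le_trans (le_max_left _ _) hb)
  have h2 := hN2 a (le_trans (le_max_right _ _) ha)
  have h3 := hN2 b (le_trans (le_max_right _ _) hb)
  rw [Real.dist_eq, abs_lt] at *
  rw [abs_le] at *
  constructor <;> linarith

open Classical in
lemma cnt_eq_sum (A : Set ℕ) (N : ℕ) :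
    (cnt A N : ℝ) = ∑ n ∈ range N, if n ∈ A then (1 : ℝ) else 0 := by
  rw [Finset.sum_boole]; rfl

lemma pos_density (u : ℕ → ℝ) (B : ℝ) (hB : ∀ n, |u n| ≤ B)
    (hm : ∀ k : ℕ, HasMean (fun n => u n ^ k))
    (ha : ∀ δ : ℝ, 0 < δ → ∃ ε : ℝ, 0 < ε ∧
      ∀ᶠ N : ℕ in atTop, (cnt {n | |u n| < ε} N : ℝ) ≤ δ * N) :
    ∃ m, Tendsto (fun N : ℕ => (cnt {n | 0 < u n} N : ℝ) / N) atTop (𝓝 m) := by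
  classical
  apply tendsto_of_approx
  intro δ hδ
  obtain ⟨ε, hε, hev⟩ := ha (δ / 2) (by positivity)
  set φ : ℝ → ℝ := fun x => max 0 (min 1 (x / ε)) with hφ
  have hφc : Continuous φ := by fun_prop
  obtain ⟨p, hp⟩ := exists_polynomial_near_of_continuousOn (-B) B φ hφc.continuousOn (δ / 2)
    (by positivity)
  refine ⟨_, poly_mean u hm p, ?_⟩
  filter_upwards [hev, eventually_gt_atTop 0] with N hN hN0
  have hN0' : (0 : ℝ) < N := by exact_mod_cast hN0
  have pt : ∀ n, |(if n ∈ {n | 0 < u n} then (1 : ℝ) else 0) - p.eval (u n)| ≤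
      (if n ∈ {n | |u n| < ε} then (1 : ℝ) else 0) + δ / 2 := by
    intro n
    have h1 := hp (u n) (abs_le.1 (hB n))
    have h2 : |(if n ∈ {n | 0 < u n} then (1 : ℝ) else 0) - φ (u n)| ≤
        (if n ∈ {n | |u n| < ε} then (1 : ℝ) else 0) := by
      simp only [Set.mem_ofPred_eq]
      have b0 : 0 ≤ φ (u n) := le_max_left _ _
      have b1 : φ (u n) ≤ 1 := max_le zero_le_one (min_le_left _ _)
      by_cases hs : |u n| < ε
      · rw [if_pos hs]
        split_ifs <;> rw [abs_le] <;> constructor <;> linarith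
      · rw [if_neg hs]
        push Not at hs
        by_cases hp : 0 < u n
        · rw [if_pos hp]
          rw [abs_of_pos hp] at hs
          have : 1 ≤ u n / ε := by rwa [le_div_iff₀ hε, one_mul]
          simp [hφ, min_eq_left this]
        · rw [if_neg hp]
          have : u n / ε ≤ 0 := div_nonpos_of_nonpos_of_nonneg (not_lt.1 hp) hε.le
          have h3 : min 1 (u n / ε) ≤ 0 := (min_le_right _ _).trans this
          simp [hφ, max_eq_left h3]
    rw [abs_lt] at h1
    rw [abs_le] at h2 ⊢
    constructor <;> linarith
  have hs : |∑ n ∈ range N, ((if n ∈ {n | 0 < u n} then (1 : ℝ) else 0) - p.eval (u n))| ≤ δ * N := by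
    refine (Finset.abs_sum_le_sum_abs _ _).trans ((Finset.sum_le_sum fun n _ => pt n).trans ?_)
    rw [Finset.sum_add_distrib, ← cnt_eq_sum]
    simp only [Finset.sum_const, card_range, nsmul_eq_mul]
    linarith
  rw [Finset.sum_sub_distrib, ← cnt_eq_sum] at hs
  rw [smul_eq_mul, inv_mul_eq_div, ← sub_div, abs_div, abs_of_pos hN0', div_le_iff₀ hN0']
  exact hs

/-- trig-polynomial-like sequences with nondegenerate frequencies have a positivity density -/
lemma trig_density (S : Finset ℂ) (hS : S.Nonempty) (hn : ∀ z ∈ S, ‖z‖ = 1)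
    (hnd : ∀ z ∈ S, ∀ w ∈ S, ∀ m : ℕ, 0 < m → z ^ m = w ^ m → z = w)
    (c : ℂ → ℂ) (hc : ∀ z ∈ S, c z ≠ 0) (u : ℕ → ℝ)
    (hu : Tendsto (fun n => (u n : ℂ) - ∑ z ∈ S, c z * z ^ n) atTop (𝓝 0)) :
    ∃ m, Tendsto (fun N : ℕ => (cnt {n | 0 < u n} N : ℝ) / N) atTop (𝓝 m) := by
  classical
  obtain ⟨B0, hB0⟩ := (Metric.isBounded_range_of_tendsto _ hu).exists_norm_le
  have hB : ∀ n, |u n| ≤ B0 + ∑ z ∈ S, ‖c z‖ := by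
    intro n
    have h1 := hB0 _ ⟨n, rfl⟩
    have h2 : ‖∑ z ∈ S, c z * z ^ n‖ ≤ ∑ z ∈ S, ‖c z‖ := by
      refine (norm_sum_le _ _).trans (Finset.sum_le_sum fun z hz => ?_)
      rw [norm_mul, norm_pow, hn z hz, one_pow, mul_one]
    have h3 := norm_add_le ((u n : ℂ) - ∑ z ∈ S, c z * z ^ n) (∑ z ∈ S, c z * z ^ n)
    rw [sub_add_cancel, Complex.norm_real, Real.norm_eq_abs] at h3
    simp only at h1
    linarith
  refine pos_density u _ hB ?_ ?_
  · intro k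
    apply HasMean.re
    have := moments S hn c (fun n => (u n : ℂ)) _ (by simpa using hB) hu k 1 (by simp)
    simpa using this
  · intro δ hδ
    obtain ⟨ε, hε, hev⟩ := anticonc S hS hn hnd c hc (δ / 2) (by positivity)
    refine ⟨ε / 2, by positivity, ?_⟩
    have hsm : ∀ᶠ n in atTop, ‖(u n : ℂ) - ∑ z ∈ S, c z * z ^ n‖ < ε / 2 := by
      have := hu.norm
      rw [norm_zero] at this
      exact this.eventually_lt_const (by positivity)
    obtain ⟨N0, hN0⟩ := eventually_atTop.1 hsm
    have hlarge : ∀ᶠ N : ℕ in atTop, 2 * N0 / δ ≤ (N : ℝ) :=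
      tendsto_natCast_atTop_atTop.eventually_ge_atTop _
    filter_upwards [hev, hlarge] with N h1 h2
    have h3 : cnt {n | |u n| < ε / 2} N ≤ cnt {n | ‖∑ z ∈ S, c z * z ^ n‖ < ε} N + N0 := by
      refine le_trans (cnt_mono (B := {n | ‖∑ z ∈ S, c z * z ^ n‖ < ε} ∪ Set.Iio N0) ?_ N) ?_
      · intro n hn
        by_cases hnN : n < N0
        · exact Or.inr hnN
        · left
          have a1 := hN0 n (not_lt.1 hnN)
          have a2 : |u n| < ε / 2 := hn
          have a3 := norm_sub_le (u n : ℂ) ((u n : ℂ) - ∑ z ∈ S, c z * z ^ n)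
          rw [sub_sub_cancel, Complex.norm_real, Real.norm_eq_abs] at a3
          show ‖∑ z ∈ S, c z * z ^ n‖ < ε
          linarith
      · refine (cnt_union_le _ _ _).trans ?_
        gcongr
        exact cnt_Iio_le _ _
    have h4 : (cnt {n | |u n| < ε / 2} N : ℝ) ≤ cnt {n | ‖∑ z ∈ S, c z * z ^ n‖ < ε} N + N0 := by
      exact_mod_cast h3
    rw [div_le_iff₀ hδ] at h2
    linarith

lemma poly_ratio (p : Polynomial ℂ) (D : ℕ) (hD : p.natDegree ≤ D) :
    Tendsto (fun n : ℕ => p.eval (n : ℂ) / (n : ℂ) ^ D - p.coeff D) atTop (𝓝 0) := by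
  have key : Tendsto (fun n : ℕ => ∑ i ∈ range D, p.coeff i * ((n : ℂ)⁻¹) ^ (D - i)) atTop (𝓝 0) := by
    rw [show (0 : ℂ) = ∑ i ∈ range D, p.coeff i * 0 ^ (D - i) from ?_]
    · refine tendsto_finsetSum _ fun i _ => ?_
      exact ((tendsto_inv_atTop_nhds_zero_nat (𝕜 := ℂ)).pow _).const_mul _
    · symm
      apply Finset.sum_eq_zero
      intro i hi
      rw [zero_pow, mul_zero]
      have := Finset.mem_range.1 hi
      omega
  refine key.congr' ?_
  filter_upwards [eventually_gt_atTop 0] with n hn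
  have hn' : (n : ℂ) ≠ 0 := by exact_mod_cast hn.ne'
  rw [Polynomial.eval_eq_sum_range' (Nat.lt_succ_of_le hD), Finset.sum_range_succ, add_div,
    mul_div_assoc, div_self (pow_ne_zero _ hn'), mul_one, add_sub_cancel_right, Finset.sum_div]
  refine Finset.sum_congr rfl fun i hi => ?_
  have hi' := Finset.mem_range.1 hi
  rw [mul_div_assoc]
  congr 1
  rw [inv_pow, eq_div_iff (pow_ne_zero _ hn'), inv_mul_eq_iff_eq_mul₀ (pow_ne_zero _ hn'),
    ← pow_add]
  congr 1; omega

lemma poly_geom (p : Polynomial ℂ) (z : ℂ) (hz : ‖z‖ < 1) :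
    Tendsto (fun n : ℕ => p.eval (n : ℂ) * z ^ n) atTop (𝓝 0) := by
  have : Tendsto (fun n : ℕ => ∑ i ∈ range (p.natDegree + 1), p.coeff i * ((n : ℂ) ^ i * z ^ n))
      atTop (𝓝 (∑ i ∈ range (p.natDegree + 1), p.coeff i * 0)) := by
    refine tendsto_finsetSum _ fun i _ => Tendsto.const_mul _ ?_
    rw [tendsto_zero_iff_norm_tendsto_zero]
    have := tendsto_pow_const_mul_const_pow_of_lt_one i (norm_nonneg z) hz
    simpa using this
  simp only [mul_zero, Finset.sum_const_zero] at this
  refine this.congr fun n => ?_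
  rw [Polynomial.eval_eq_sum_range, Finset.sum_mul]
  exact Finset.sum_congr rfl fun i _ => by ring

lemma term_lim (p : Polynomial ℂ) (D : ℕ) (ρ : ℝ) (hρ : 0 < ρ) (z : ℂ)
    (h : ‖z‖ < ρ ∨ (‖z‖ = ρ ∧ p.natDegree ≤ D)) :
    Tendsto (fun n : ℕ => p.eval (n : ℂ) * z ^ n / ((n : ℂ) ^ D * (ρ : ℂ) ^ n) -
      (if ‖z‖ = ρ then p.coeff D * (z / ρ) ^ n else 0)) atTop (𝓝 0) := by
  have hρ' : (ρ : ℂ) ≠ 0 := by exact_mod_cast hρ.ne'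
  rcases h with h | ⟨h, hD⟩
  · simp only [if_neg h.ne, sub_zero]
    have h1 := poly_geom p (z / ρ) (by
      rw [norm_div, Complex.norm_real, Real.norm_of_nonneg hρ.le, div_lt_one hρ]; exact h)
    refine squeeze_zero_norm' (a := fun n : ℕ => ‖p.eval (n : ℂ) * (z / ρ) ^ n‖) ?_ ?_
    · filter_upwards [eventually_gt_atTop 0] with n hn
      rw [div_pow, mul_div_assoc', div_mul_eq_div_div_swap, norm_div _ ((n : ℂ) ^ D)]
      apply div_le_self (norm_nonneg _)
      rw [norm_pow, Complex.norm_natCast]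
      exact one_le_pow₀ (by exact_mod_cast hn)
    · simpa using h1.norm
  · simp only [if_pos h]
    refine squeeze_zero_norm (a := fun n : ℕ => ‖p.eval (n : ℂ) / (n : ℂ) ^ D - p.coeff D‖) ?_ ?_
    · intro n
      have : p.eval (n : ℂ) * z ^ n / ((n : ℂ) ^ D * (ρ : ℂ) ^ n) - p.coeff D * (z / ρ) ^ n =
          (p.eval (n : ℂ) / (n : ℂ) ^ D - p.coeff D) * (z / ρ) ^ n := by
        rw [mul_div_mul_comm, div_pow]; ring
      rw [this, norm_mul, norm_pow, norm_div, Complex.norm_real, Real.norm_of_nonneg hρ.le, h,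
        div_self hρ.ne', one_pow, mul_one]
    · simpa using (poly_ratio p D hD).norm

/-- value of an exponential polynomial -/
noncomputable def epoly (P : ℂ →₀ Polynomial ℂ) (n : ℕ) : ℂ :=
  P.sum fun z p => p.eval (n : ℂ) * z ^ n

lemma epoly_add (P Q : ℂ →₀ Polynomial ℂ) (n : ℕ) : epoly (P + Q) n = epoly P n + epoly Q n := by
  classical
  unfold epoly
  rw [Finsupp.sum_add_index'] <;> intros <;> simp [add_mul]

lemma epoly_single (z : ℂ) (p : Polynomial ℂ) (n : ℕ) :
    epoly (Finsupp.single z p) n = p.eval (n : ℂ) * z ^ n := by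
  unfold epoly
  rw [Finsupp.sum_single_index]; simp

/-- restriction to an arithmetic progression -/
lemma epoly_AP (P : ℂ →₀ Polynomial ℂ) (M a : ℕ) : ∃ Q : ℂ →₀ Polynomial ℂ,
    (∀ w ∈ Q.support, ∃ z ∈ P.support, w = z ^ M) ∧
    ∀ b : ℕ, epoly Q b = epoly P (a + M * b) := by
  classical
  set q : ℂ → Polynomial ℂ → Polynomial ℂ := fun z p => Polynomial.C (z ^ a) *
    p.comp (Polynomial.C (M : ℂ) * Polynomial.X + Polynomial.C (a : ℂ)) with hq
  refine ⟨P.sum fun z p => Finsupp.single (z ^ M) (q z p), ?_, ?_⟩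
  · intro w hw
    have := Finsupp.support_sum hw
    simp only [Finset.mem_biUnion] at this
    obtain ⟨z, hz, h⟩ := this
    have := Finsupp.support_single_subset h
    exact ⟨z, hz, by simpa using this⟩
  · intro b
    unfold epoly
    rw [Finsupp.sum_sum_index (by intros; simp) (by intros; simp [add_mul])]
    refine Finsupp.sum_congr fun z _ => ?_
    rw [Finsupp.sum_single_index (by simp)]
    simp only [hq, Polynomial.eval_mul, Polynomial.eval_C, Polynomial.eval_comp,
      Polynomial.eval_add, Polynomial.eval_X]
    push_cast
    rw [pow_add, pow_mul, add_comm (a : ℂ)]; ring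

lemma exists_M (S : Finset ℂ) : ∃ M : ℕ, 0 < M ∧ ∀ z ∈ S, ∀ w ∈ S, ∀ m : ℕ, 0 < m →
    z ^ m = w ^ m → z ^ M = w ^ M := by
  classical
  have : ∀ T : Finset (ℂ × ℂ), ∃ M : ℕ, 0 < M ∧ ∀ x ∈ T, ∀ m : ℕ, 0 < m →
      x.1 ^ m = x.2 ^ m → x.1 ^ M = x.2 ^ M := by
    intro T
    induction T using Finset.induction_on with
    | empty => exact ⟨1, one_pos, by simp⟩
    | insert x T hx ih =>
      obtain ⟨M, hM, h⟩ := ih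
      by_cases hex : ∃ m : ℕ, 0 < m ∧ x.1 ^ m = x.2 ^ m
      · obtain ⟨k, hk, hk2⟩ := hex
        refine ⟨M * k, by positivity, ?_⟩
        intro y hy m hm hym
        rcases Finset.mem_insert.1 hy with rfl | hy
        · rw [mul_comm, pow_mul, pow_mul, hk2]
        · rw [pow_mul, pow_mul, h y hy m hm hym]
      · refine ⟨M, hM, ?_⟩
        intro y hy m hm hym
        rcases Finset.mem_insert.1 hy with rfl | hy
        · exact absurd ⟨m, hm, hym⟩ hex
        · exact h y hy m hm hym
  obtain ⟨M, hM, h⟩ := this (S ×ˢ S)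
  exact ⟨M, hM, fun z hz w hw => h (z, w) (by simp [hz, hw])⟩

lemma density_congr {A B : Set ℕ} (N0 : ℕ) (h : ∀ n, N0 ≤ n → (n ∈ A ↔ n ∈ B)) {m : ℝ}
    (hB : Tendsto (fun N : ℕ => (cnt B N : ℝ) / N) atTop (𝓝 m)) :
    Tendsto (fun N : ℕ => (cnt A N : ℝ) / N) atTop (𝓝 m) := by
  have key : ∀ A B : Set ℕ, (∀ n, N0 ≤ n → n ∈ A → n ∈ B) → ∀ N, (cnt A N : ℝ) ≤ cnt B N + N0 := by
    intro A B h N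
    have : cnt A N ≤ cnt B N + N0 := by
      refine (cnt_mono (B := B ∪ Set.Iio N0) ?_ N).trans ((cnt_union_le _ _ _).trans ?_)
      · intro n hn
        by_cases hN : n < N0
        · exact Or.inr hN
        · exact Or.inl (h n (not_lt.1 hN) hn)
      · gcongr
        exact cnt_Iio_le _ _
    exact_mod_cast this
  have h1 := key A B (fun n hn => (h n hn).1)
  have h2 := key B A (fun n hn => (h n hn).2)
  have h3 : Tendsto (fun N : ℕ => (cnt A N : ℝ) / N - (cnt B N : ℝ) / N) atTop (𝓝 0) := by
    refine squeeze_zero_norm (a := fun N : ℕ => (N0 : ℝ) / N) ?_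
      (tendsto_const_div_atTop_nhds_zero_nat _)
    intro N
    rw [← sub_div, norm_div, Real.norm_natCast, Real.norm_eq_abs]
    gcongr
    rw [abs_le]
    constructor <;> linarith [h1 N, h2 N]
  simpa using h3.add hB

lemma epoly_density (P : ℂ →₀ Polynomial ℂ) (h0 : ∀ z ∈ P.support, z ≠ 0)
    (hnd : ∀ z ∈ P.support, ∀ w ∈ P.support, ∀ m : ℕ, 0 < m → z ^ m = w ^ m → z = w)
    (f : ℕ → ℝ) (N0 : ℕ) (hf : ∀ n, N0 ≤ n → (f n : ℂ) = epoly P n) :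
    ∃ m, Tendsto (fun N : ℕ => (cnt {n | 0 < f n} N : ℝ) / N) atTop (𝓝 m) := by
  classical
  by_cases hP : P.support.Nonempty
  · obtain ⟨z0, hz0, hmax⟩ := Finset.exists_max_image P.support
      (fun z => toLex (‖z‖, (P z).natDegree)) hP
    set ρ : ℝ := ‖z0‖ with hρ
    set D : ℕ := (P z0).natDegree with hD
    have hρ0 : 0 < ρ := norm_pos_iff.2 (h0 z0 hz0)
    have hρc : (ρ : ℂ) ≠ 0 := by exact_mod_cast hρ0.ne'
    have hdom : ∀ z ∈ P.support, ‖z‖ < ρ ∨ (‖z‖ = ρ ∧ (P z).natDegree ≤ D) := by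
      intro z hz
      have := hmax z hz
      rw [Prod.Lex.le_iff] at this
      exact this
    set S0 := P.support.filter (fun z => ‖z‖ = ρ ∧ (P z).coeff D ≠ 0) with hS0
    set S := S0.image (fun z => z / (ρ : ℂ)) with hS
    set c : ℂ → ℂ := fun w => (P (w * ρ)).coeff D with hc
    set u : ℕ → ℝ := fun n => f n / ((n : ℝ) ^ D * ρ ^ n) with hu
    have hlim : Tendsto (fun n : ℕ => ∑ z ∈ P.support,
        ((P z).eval (n : ℂ) * z ^ n / ((n : ℂ) ^ D * (ρ : ℂ) ^ n) -
        (if ‖z‖ = ρ then (P z).coeff D * (z / ρ) ^ n else 0))) atTop (𝓝 0) := by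
      have := tendsto_finsetSum P.support fun z hz => term_lim (P z) D ρ hρ0 z (hdom z hz)
      rwa [Finset.sum_const_zero] at this
    have hsum : ∀ n : ℕ, ∑ w ∈ S, c w * w ^ n =
        ∑ z ∈ P.support, (if ‖z‖ = ρ then (P z).coeff D * (z / ρ) ^ n else 0) := by
      intro n
      rw [hS, Finset.sum_image (fun x _ y _ h => by
        simpa [div_left_inj' hρc] using h), hS0, Finset.sum_filter]
      refine Finset.sum_congr rfl fun z _ => ?_
      simp only [hc, div_mul_cancel₀ _ hρc]
      by_cases h1 : ‖z‖ = ρ <;> by_cases h2 : (P z).coeff D = 0 <;> simp [h1, h2]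
    have hmem : ∀ w ∈ S, ∃ z ∈ P.support, ‖z‖ = ρ ∧ (P z).coeff D ≠ 0 ∧ w = z / ρ := by
      intro w hw
      obtain ⟨z, hz, rfl⟩ := Finset.mem_image.1 hw
      obtain ⟨h1, h2, h3⟩ := Finset.mem_filter.1 hz
      exact ⟨z, h1, h2, h3, rfl⟩
    have key : ∃ m, Tendsto (fun N : ℕ => (cnt {n | 0 < u n} N : ℝ) / N) atTop (𝓝 m) := by
      refine trig_density S ?_ ?_ ?_ c ?_ u ?_
      · refine ⟨z0 / ρ, Finset.mem_image_of_mem _ (Finset.mem_filter.2 ⟨hz0, rfl, ?_⟩)⟩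
        rw [hD, Polynomial.coeff_natDegree, Polynomial.leadingCoeff_ne_zero]
        simpa using hz0
      · intro w hw
        obtain ⟨z, _, h2, _, rfl⟩ := hmem w hw
        rw [norm_div, Complex.norm_real, Real.norm_of_nonneg hρ0.le, h2, div_self hρ0.ne']
      · intro w hw w' hw' k hk hkk
        obtain ⟨z, h1, _, _, rfl⟩ := hmem w hw
        obtain ⟨z', h1', _, _, rfl⟩ := hmem w' hw'
        rw [div_pow, div_pow, div_left_inj' (pow_ne_zero _ hρc)] at hkk
        rw [hnd z h1 z' h1' k hk hkk]
      · intro w hw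
        obtain ⟨z, _, _, h3, rfl⟩ := hmem w hw
        simpa only [hc, div_mul_cancel₀ _ hρc] using h3
      · refine hlim.congr' ?_
        filter_upwards [eventually_ge_atTop N0] with n hn
        rw [Finset.sum_sub_distrib, hsum n, ← Finset.sum_div]
        congr 1
        simp only [hu]
        push_cast
        rw [hf n hn]
        rfl
    obtain ⟨m, hm⟩ := key
    refine ⟨m, density_congr 1 ?_ hm⟩
    intro n hn
    have : (0 : ℝ) < (n : ℝ) ^ D * ρ ^ n := by
      have : (0 : ℝ) < n := by exact_mod_cast hn
      positivity
    simp only [Set.mem_ofPred_eq, hu]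
    rw [div_pos_iff_of_pos_right this]
  · rw [Finset.not_nonempty_iff_eq_empty, Finsupp.support_eq_empty] at hP
    refine ⟨0, density_congr (B := ∅) N0 ?_ ?_⟩
    · intro n hn
      have := hf n hn
      rw [hP] at this
      simp only [epoly, Finsupp.sum_zero_index] at this
      have h : f n = 0 := by exact_mod_cast this
      simp [h]
    · simp [cnt]

/-- gluing residue classes -/
lemma density_glue (A : Set ℕ) (M : ℕ) (hM : 0 < M)
    (h : ∀ a : ℕ, ∃ m, Tendsto (fun N : ℕ => (cnt {b | a + M * b ∈ A} N : ℝ) / N) atTop (𝓝 m)) :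
    ∃ m, Tendsto (fun N : ℕ => (cnt A N : ℝ) / N) atTop (𝓝 m) := by
  classical
  choose m hm using h
  have hblock : ∀ K : ℕ, (cnt A (M * K) : ℝ) =
      ∑ a ∈ range M, (cnt {b | a + M * b ∈ A} K : ℝ) := by
    intro K
    simp only [cnt_eq_sum]
    induction K with
    | zero => simp
    | succ K ih =>
      rw [Nat.mul_succ, Finset.sum_range_add, ih, ← Finset.sum_add_distrib]
      refine Finset.sum_congr rfl fun a _ => ?_
      rw [Finset.sum_range_succ]
      simp [add_comm]
  have hdiv : Tendsto (fun N : ℕ => N / M) atTop atTop := Nat.tendsto_div_const_atTop hM.ne'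
  have h1 : Tendsto (fun K : ℕ => (cnt A (M * K) : ℝ) / K) atTop (𝓝 (∑ a ∈ range M, m a)) := by
    refine (tendsto_finsetSum _ fun a _ => hm a).congr fun K => ?_
    rw [hblock, Finset.sum_div]
  have h2 := h1.comp hdiv
  have h3 : Tendsto (fun N : ℕ => ((N / M : ℕ) : ℝ) / N) atTop (𝓝 (1 / M)) := by
    have := (tendsto_nat_floor_mul_div_atTop (R := ℝ) (a := 1 / M) (by positivity)).comp
      tendsto_natCast_atTop_atTop
    refine this.congr fun N => ?_
    simp only [Function.comp]
    rw [one_div_mul_eq_div, Nat.floor_div_natCast, Nat.floor_natCast]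
  have h4 : Tendsto (fun N : ℕ => (cnt A (M * (N / M)) : ℝ) / N) atTop
      (𝓝 ((∑ a ∈ range M, m a) * (1 / M))) := by
    refine (h2.mul h3).congr' ?_
    filter_upwards [eventually_ge_atTop M] with N hN
    have : ((N / M : ℕ) : ℝ) ≠ 0 := by
      have := Nat.div_pos hN hM
      exact_mod_cast this.ne'
    simp only [Function.comp]
    field_simp
  have h5 : Tendsto (fun N : ℕ => (cnt A N : ℝ) / N - (cnt A (M * (N / M)) : ℝ) / N) atTop (𝓝 0) := by
    refine squeeze_zero_norm (a := fun N : ℕ => (M : ℝ) / N) ?_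
      (tendsto_const_div_atTop_nhds_zero_nat _)
    intro N
    rw [← sub_div, norm_div, Real.norm_natCast, Real.norm_eq_abs]
    gcongr
    have e : N = M * (N / M) + N % M := (Nat.div_add_mod N M).symm
    have e2 : (cnt A N : ℝ) - cnt A (M * (N / M)) =
        ∑ x ∈ range (N % M), if M * (N / M) + x ∈ A then (1 : ℝ) else 0 := by
      conv_lhs => enter [1, 1, 2]; rw [e]
      rw [cnt_eq_sum, cnt_eq_sum, Finset.sum_range_add]; ring
    rw [e2]
    refine (Finset.abs_sum_le_sum_abs _ _).trans ?_
    calc _ ≤ ∑ x ∈ range (N % M), (1 : ℝ) := by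
          refine Finset.sum_le_sum fun x _ => ?_
          split_ifs <;> simp
      _ = ((N % M : ℕ) : ℝ) := by simp
      _ ≤ M := by exact_mod_cast (Nat.mod_lt N hM).le
  exact ⟨_, by simpa using h5.add h4⟩

lemma epoly_density' (P : ℂ →₀ Polynomial ℂ) (h0 : ∀ z ∈ P.support, z ≠ 0)
    (f : ℕ → ℝ) (N0 : ℕ) (hf : ∀ n, N0 ≤ n → (f n : ℂ) = epoly P n) :
    ∃ m, Tendsto (fun N : ℕ => (cnt {n | 0 < f n} N : ℝ) / N) atTop (𝓝 m) := by
  obtain ⟨M, hM, hM2⟩ := exists_M P.support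
  refine density_glue _ M hM fun a => ?_
  obtain ⟨Q, hQ, hQe⟩ := epoly_AP P M a
  refine epoly_density Q ?_ ?_ (fun b => f (a + M * b)) N0 ?_
  · intro w hw
    obtain ⟨z, hz, rfl⟩ := hQ w hw
    exact pow_ne_zero _ (h0 z hz)
  · intro w hw w' hw' k hk hkk
    obtain ⟨z, hz, rfl⟩ := hQ w hw
    obtain ⟨z', hz', rfl⟩ := hQ w' hw'
    rw [← pow_mul, ← pow_mul] at hkk
    exact hM2 z hz z' hz' (M * k) (by positivity) hkk
  · intro b hb
    rw [hQe]
    apply hf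
    nlinarith

lemma geneig_epoly {V : Type*} [AddCommGroup V] [Module ℂ V] (T : Module.End ℂ V)
    (L : V →ₗ[ℂ] ℂ) (z : ℂ) (k : ℕ) (v : V) (hv : ((T - algebraMap ℂ _ z) ^ k) v = 0) :
    ∃ P : ℂ →₀ Polynomial ℂ, P 0 = 0 ∧ ∃ N0 : ℕ, ∀ n, N0 ≤ n → L ((T ^ n) v) = epoly P n := by
  set U := T - algebraMap ℂ (Module.End ℂ V) z with hU
  have hT : T = U + algebraMap ℂ (Module.End ℂ V) z := by rw [hU]; abel
  have hvan : ∀ j, k ≤ j → (U ^ j) v = 0 := by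
    intro j hj
    obtain ⟨i, rfl⟩ := Nat.exists_eq_add_of_le hj
    rw [add_comm, pow_add, Module.End.mul_apply, hv, map_zero]
  have hexp : ∀ n, k ≤ n → L ((T ^ n) v) =
      ∑ j ∈ range k, z ^ (n - j) * (n.choose j : ℂ) * L ((U ^ j) v) := by
    intro n hn
    rw [hT, (show Commute U (algebraMap ℂ (Module.End ℂ V) z) from (Algebra.commutes z U).symm).add_pow]
    rw [LinearMap.sum_apply, map_sum]
    have hsub : range k ⊆ range (n + 1) := by
      intro x; simp only [mem_range]; omega
    have hterm : ∀ j, L ((U ^ j * (algebraMap ℂ (Module.End ℂ V) z) ^ (n - j) *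
        (n.choose j : Module.End ℂ V)) v) = z ^ (n - j) * (n.choose j : ℂ) * L ((U ^ j) v) := by
      intro j
      rw [← map_pow, ← map_natCast (algebraMap ℂ (Module.End ℂ V)), mul_assoc, ← map_mul,
        Module.End.mul_apply, Module.algebraMap_end_apply, map_smul, map_smul, smul_eq_mul]
    simp only [hterm]
    symm
    apply Finset.sum_subset hsub
    intro j _ hj
    rw [hvan j (by simpa using hj), map_zero, mul_zero]
  by_cases hz : z = 0
  · refine ⟨0, rfl, 2 * k + 1, fun n hn => ?_⟩
    rw [hexp n (by omega)]
    simp only [epoly, Finsupp.sum_zero_index]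
    apply Finset.sum_eq_zero
    intro j hj
    have := Finset.mem_range.1 hj
    rw [hz, zero_pow (by omega), zero_mul, zero_mul]
  · refine ⟨Finsupp.single z (∑ j ∈ range k, Polynomial.C (L ((U ^ j) v) * (z ^ j)⁻¹ *
      ((j.factorial : ℂ))⁻¹) * descPochhammer ℂ j), ?_, k, fun n hn => ?_⟩
    · rw [Finsupp.single_apply, if_neg hz]
    · rw [hexp n hn, epoly_single, Polynomial.eval_finsetSum, Finset.sum_mul]
      refine Finset.sum_congr rfl fun j hj => ?_
      have hj' := Finset.mem_range.1 hj
      rw [Polynomial.eval_mul, Polynomial.eval_C, descPochhammer_eval_eq_descFactorial,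
        Nat.descFactorial_eq_factorial_mul_choose]
      have h1 : (j.factorial : ℂ) ≠ 0 := by exact_mod_cast j.factorial_ne_zero
      have h2 : z ^ n = z ^ (n - j) * z ^ j := by rw [← pow_add]; congr 1; omega
      have h3 : z ^ j ≠ 0 := pow_ne_zero _ hz
      rw [h2]
      push_cast
      field_simp

lemma end_epoly {V : Type*} [AddCommGroup V] [Module ℂ V] [FiniteDimensional ℂ V]
    (T : Module.End ℂ V) (L : V →ₗ[ℂ] ℂ) (v : V) :
    ∃ P : ℂ →₀ Polynomial ℂ, P 0 = 0 ∧ ∃ N0 : ℕ, ∀ n, N0 ≤ n → L ((T ^ n) v) = epoly P n := by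
  have hv : v ∈ ⨆ μ : ℂ, T.maxGenEigenspace μ := by
    rw [Module.End.iSup_maxGenEigenspace_eq_top]; trivial
  induction hv using Submodule.iSup_induction' with
  | mem μ x hx =>
    rw [Module.End.mem_maxGenEigenspace] at hx
    obtain ⟨k, hk⟩ := hx
    exact geneig_epoly T L μ k x hk
  | zero => exact ⟨0, rfl, 0, fun n _ => by simp [epoly]⟩
  | add x y _ _ hx hy =>
    obtain ⟨P, hP, N, hN⟩ := hx
    obtain ⟨Q, hQ, K, hK⟩ := hy
    refine ⟨P + Q, by simp [hP, hQ], max N K, fun n hn => ?_⟩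
    rw [epoly_add, map_add, map_add, hN n (le_trans (le_max_left _ _) hn),
      hK n (le_trans (le_max_right _ _) hn)]

lemma rec_epoly (f : ℕ → ℂ) (h : ℕ) (hh : 0 < h) (c : Fin h → ℂ)
    (hf : ∀ n : ℕ, f (n + h) = ∑ k : Fin h, c k * f (n + k)) :
    ∃ P : ℂ →₀ Polynomial ℂ, P 0 = 0 ∧ ∃ N0 : ℕ, ∀ n, N0 ≤ n → f n = epoly P n := by
  let T : Module.End ℂ (Fin h → ℂ) :=
    { toFun := fun v i => if hi : (i : ℕ) + 1 < h then v ⟨i + 1, hi⟩ else ∑ k, c k * v k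
      map_add' := by
        intro v w; ext i
        simp only [Pi.add_apply]
        split_ifs
        · rfl
        · simp [mul_add, Finset.sum_add_distrib]
      map_smul' := by
        intro a v; ext i
        simp only [Pi.smul_apply, RingHom.id_apply, smul_eq_mul]
        split_ifs
        · rfl
        · rw [Finset.mul_sum]; exact Finset.sum_congr rfl fun k _ => by ring }
  have hT : ∀ n : ℕ, (T ^ n) (fun i : Fin h => f i) = fun i : Fin h => f (n + i) := by
    intro n
    induction n with
    | zero => simp
    | succ n ih =>
      rw [pow_succ', Module.End.mul_apply, ih]
      ext i
      show (if hi : (i : ℕ) + 1 < h then f (n + (i + 1)) else ∑ k : Fin h, c k * f (n + k)) = _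
      split_ifs with hi
      · congr 1; omega
      · rw [← hf n]
        congr 1
        have := i.2
        omega
  obtain ⟨P, hP, N0, hN⟩ := end_epoly T (LinearMap.proj (⟨0, hh⟩ : Fin h)) (fun i : Fin h => f i)
  refine ⟨P, hP, N0, fun n hn => ?_⟩
  rw [← hN n hn, hT]
  simp

theorem density_of_positivity_set_exists (f : ℕ → ℝ) (hf : IsLinearRecurrence f) :
    ∃ δ : ℝ, HasNatDensity {n : ℕ | 0 < f n} δ := by
  classical
  obtain ⟨h, hh, c, hc⟩ := hf
  obtain ⟨P, hP, N0, hN⟩ := rec_epoly (fun n => (f n : ℂ)) h hh (fun k => (c k : ℂ)) (by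
    intro n
    rw [hc n]
    push_cast
    rfl)
  obtain ⟨m, hm⟩ := epoly_density' P (by
    rintro z hz rfl
    exact (Finsupp.mem_support_iff.1 hz) hP) f N0 hN
  refine ⟨m, ?_⟩
  unfold HasNatDensity
  have h1 : Tendsto (fun x : ℕ => (((x + 1 : ℕ) : ℝ)) / x) atTop (𝓝 1) := by
    have := (tendsto_inv_atTop_nhds_zero_nat (𝕜 := ℝ)).const_add 1
    rw [add_zero] at this
    refine this.congr' ?_
    filter_upwards [eventually_gt_atTop 0] with x hx
    have : (x : ℝ) ≠ 0 := by exact_mod_cast hx.ne'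
    push_cast
    field_simp
  have h2 := (hm.comp (tendsto_add_atTop_nat 1)).mul h1
  rw [mul_one] at h2
  refine h2.congr fun x => ?_
  have hcard : ({n : ℕ | 0 < f n} ∩ Set.Iic x).ncard = cnt {n : ℕ | 0 < f n} (x + 1) := by
    unfold cnt
    rw [← Set.ncard_coe_finset]
    congr 1
    ext n
    simp [and_comm]
  rw [hcard]
  have : ((x + 1 : ℕ) : ℝ) ≠ 0 := by positivity
  simp only [Function.comp]
  field_simp
end

section
/- Let (f_n)_{n≥0} be a real recurrence sequence. Then the natural density of the zero set {n ∈ ℕ : f_n = 0} exists and is a rational number. -/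
open Polynomial Filter Topology

noncomputable section

/-- Counting function of a set below `n`, as a real number. -/
def cntBelow (A : Set ℕ) (n : ℕ) : ℝ := ∑ i ∈ Finset.range n, A.indicator (fun _ => (1:ℝ)) i

/-- Density in terms of `cntBelow`. -/
def DensAux (A : Set ℕ) (d : ℝ) : Prop :=
  Tendsto (fun n : ℕ => cntBelow A n / n) atTop (𝓝 d)

lemma cntBelow_succ (A : Set ℕ) (n : ℕ) :
    cntBelow A (n+1) = cntBelow A n + A.indicator (fun _ => (1:ℝ)) n := by
  simp [cntBelow, Finset.sum_range_succ]

lemma ind_nonneg (A : Set ℕ) (n : ℕ) : 0 ≤ A.indicator (fun _ => (1:ℝ)) n :=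
  Set.indicator_nonneg (fun _ _ => zero_le_one) n

lemma ind_le_one (A : Set ℕ) (n : ℕ) : A.indicator (fun _ => (1:ℝ)) n ≤ 1 := by
  by_cases h : n ∈ A <;> simp [h]

lemma cntBelow_nonneg (A : Set ℕ) (n : ℕ) : 0 ≤ cntBelow A n :=
  Finset.sum_nonneg fun i _ => ind_nonneg A i

lemma cntBelow_union (A B E : Set ℕ) (h : A ⊆ B ∪ E) (n : ℕ) :
    cntBelow A n ≤ cntBelow B n + cntBelow E n := by
  unfold cntBelow
  rw [← Finset.sum_add_distrib]
  refine Finset.sum_le_sum fun i _ => ?_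
  have h1 := ind_nonneg B i
  have h2 := ind_nonneg E i
  by_cases hA : i ∈ A
  · rcases h hA with hB | hE
    · simp only [Set.indicator_of_mem hA, Set.indicator_of_mem hB]; linarith
    · simp only [Set.indicator_of_mem hA, Set.indicator_of_mem hE]; linarith
  · rw [Set.indicator_of_notMem hA]; linarith

lemma cntBelow_shift (A : Set ℕ) (n : ℕ) :
    cntBelow A n ≤ 1 + cntBelow {m | m + 1 ∈ A} n := by
  have h : cntBelow A (n+1) = cntBelow {m | m + 1 ∈ A} n + A.indicator (fun _ => (1:ℝ)) 0 := by
    unfold cntBelow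
    rw [Finset.sum_range_succ']
    rfl
  have := cntBelow_succ A n
  have := ind_nonneg A n
  have := ind_le_one A 0
  linarith

lemma cntBelow_le (A : Set ℕ) (n : ℕ) : cntBelow A n ≤ n := by
  unfold cntBelow
  calc _ ≤ ∑ i ∈ Finset.range n, (1:ℝ) := Finset.sum_le_sum fun i _ => ind_le_one A i
    _ = n := by simp

lemma tendsto_const_div (c : ℝ) : Tendsto (fun n : ℕ => c / n) atTop (𝓝 0) :=
  tendsto_const_div_atTop_nhds_zero_nat c

lemma densZero_of_le {A : Set ℕ} {u : ℕ → ℝ} (hu : Tendsto (fun n : ℕ => u n / n) atTop (𝓝 0))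
    (h : ∀ n, cntBelow A n ≤ u n) : DensAux A 0 := by
  refine squeeze_zero (fun n => div_nonneg (cntBelow_nonneg A n) (Nat.cast_nonneg n))
    (fun n => ?_) hu
  exact div_le_div_of_nonneg_right (h n) (Nat.cast_nonneg n)

lemma densZero_union {A B E : Set ℕ} (hB : DensAux B 0) (hE : DensAux E 0) (h : A ⊆ B ∪ E) :
    DensAux A 0 := by
  refine densZero_of_le (u := fun n => cntBelow B n + cntBelow E n) ?_ (cntBelow_union A B E h)
  have := Tendsto.add hB hE
  simpa [add_div] using this

lemma densZero_mono {A B : Set ℕ} (hB : DensAux B 0) (h : A ⊆ B) : DensAux A 0 :=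
  densZero_union hB hB (h.trans Set.subset_union_left)

lemma densZero_empty : DensAux ∅ 0 := by
  simp [DensAux, cntBelow]

lemma densZero_shift {A : Set ℕ} (h : DensAux {m | m + 1 ∈ A} 0) : DensAux A 0 := by
  refine densZero_of_le (u := fun n => 1 + cntBelow {m | m + 1 ∈ A} n) ?_ (cntBelow_shift A)
  have := Tendsto.add (tendsto_const_div 1) h
  simpa [add_div] using this

lemma densZero_shift_iter {A : Set ℕ} (k : ℕ) (h : DensAux {m | m + k ∈ A} 0) : DensAux A 0 := by
  induction k generalizing A with
  | zero => simpa using h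
  | succ k ih =>
    refine densZero_shift (ih ?_)
    simpa [add_assoc] using h

lemma dens_one {A : Set ℕ} (k : ℕ) (h : ∀ n, n + k ∈ A) : DensAux A 1 := by
  have h0 : DensAux Aᶜ 0 := by
    refine densZero_shift_iter k ?_
    refine densZero_mono densZero_empty ?_
    intro m hm
    exact hm (h m)
  have h1 : ∀ n, cntBelow A n = n - cntBelow Aᶜ n := by
    intro n
    have : cntBelow A n + cntBelow Aᶜ n = n := by
      unfold cntBelow
      rw [← Finset.sum_add_distrib]
      simp [Set.indicator_self_add_compl_apply]
    linarith
  have h2 : Tendsto (fun n : ℕ => (1:ℝ) - cntBelow Aᶜ n / n) atTop (𝓝 (1 - 0)) :=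
    tendsto_const_nhds.sub h0
  rw [sub_zero] at h2
  refine h2.congr' ?_
  filter_upwards [eventually_gt_atTop 0] with n hn
  have : (n:ℝ) ≠ 0 := by positivity
  rw [h1]; field_simp

lemma cntBelow_gap (B : Set ℕ) (m k : ℕ) (h : ∀ i, m ≤ i → i < m + k → i ∉ B) :
    cntBelow B (m + k) = cntBelow B m := by
  induction k with
  | zero => rfl
  | succ k ih =>
    rw [← add_assoc, cntBelow_succ, ih (fun i h1 h2 => h i h1 (by omega)),
      Set.indicator_of_notMem (h _ (by omega) (by omega)), add_zero]

lemma cntBelow_sparse (B : Set ℕ) (K : ℕ) (h : ∀ n ∈ B, ∀ j, 1 ≤ j → j ≤ K → n + j ∉ B) (n : ℕ) :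
    K * cntBelow B n ≤ n + K := by
  induction n using Nat.strong_induction_on with
  | _ n ih =>
    rcases n with _ | n
    · simp [cntBelow]
    · rw [cntBelow_succ]
      by_cases hn : n ∈ B
      · rw [Set.indicator_of_mem hn]
        have gap : ∀ i, n ≤ i + K → i < n → i ∉ B := by
          intro i h1 h2 hi
          apply h i hi (n - i) (by omega) (by omega)
          rwa [Nat.add_sub_cancel' h2.le]
        have key : K * cntBelow B n ≤ n := by
          by_cases hK : K ≤ n
          · have e := cntBelow_gap B (n - K) K (fun i h1 h2 => gap i (by omega) (by omega))
            rw [Nat.sub_add_cancel hK] at e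
            have := ih (n - K) (by omega)
            rw [e]
            push_cast [hK] at this
            linarith
          · have e := cntBelow_gap B 0 n (fun i h1 h2 => gap i (by omega) (by omega))
            rw [zero_add] at e
            rw [e]
            simp [cntBelow]
        push_cast
        linarith
      · rw [Set.indicator_of_notMem hn]
        have := ih n (by omega)
        push_cast
        linarith

/-- If every `A ∩ (A - h)` has density zero, so has `A`. -/
lemma densZero_of_shifts {A : Set ℕ} (hA : ∀ h, 1 ≤ h → DensAux {n | n ∈ A ∧ n + h ∈ A} 0) :
    DensAux A 0 := by
  have hD : ∀ K : ℕ, DensAux {n | n ∈ A ∧ ∃ j, 1 ≤ j ∧ j ≤ K ∧ n + j ∈ A} 0 := by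
    intro K
    induction K with
    | zero =>
      refine densZero_mono densZero_empty ?_
      rintro n ⟨_, j, h1, h2, _⟩
      omega
    | succ K ih =>
      refine densZero_union ih (hA (K+1) (by omega)) ?_
      rintro n ⟨hn, j, h1, h2, h3⟩
      rcases Nat.lt_or_ge K j with h | h
      · right
        obtain rfl : j = K + 1 := by omega
        exact ⟨hn, h3⟩
      · left
        exact ⟨hn, j, h1, h, h3⟩
  have bound : ∀ K : ℕ, 1 ≤ K → ∀ n, cntBelow A n ≤ (n / K + 1) +
      cntBelow {n | n ∈ A ∧ ∃ j, 1 ≤ j ∧ j ≤ K ∧ n + j ∈ A} n := by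
    intro K hK n
    set D := {n | n ∈ A ∧ ∃ j, 1 ≤ j ∧ j ≤ K ∧ n + j ∈ A} with hDdef
    have h1 := cntBelow_union A (A \ D) D (by intro x hx; by_cases h : x ∈ D <;> simp [h, hx]) n
    have h2 := cntBelow_sparse (A \ D) K (by
      rintro n ⟨hn, hnD⟩ j h1 h2 ⟨h3, _⟩
      exact hnD ⟨hn, j, h1, h2, h3⟩) n
    have hK' : (0:ℝ) < K := by exact_mod_cast hK
    have h3 : cntBelow (A \ D) n ≤ n / K + 1 := by
      rw [← sub_nonneg] at h2 ⊢
      have : (n:ℝ) / K + 1 - cntBelow (A \ D) n = (n + K - K * cntBelow (A \ D) n) / K := by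
        field_simp
      rw [this]; positivity
    linarith
  unfold DensAux
  rw [Metric.tendsto_atTop']
  intro ε hε
  obtain ⟨K, hK⟩ := exists_nat_one_div_lt (show 0 < ε / 2 by positivity)
  have hlim := Tendsto.add (tendsto_const_div 1) (hD (K+1))
  rw [add_zero, Metric.tendsto_atTop'] at hlim
  obtain ⟨N, hN⟩ := hlim (ε/2) (by positivity)
  refine ⟨N, fun n hn => ?_⟩
  have h1 := hN n hn
  have hnpos : (0:ℝ) < n := by exact_mod_cast (by omega : 0 < n)
  rw [Real.dist_eq, sub_zero] at h1 ⊢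
  have h2 := (le_abs_self _).trans_lt h1
  rw [abs_of_nonneg (div_nonneg (cntBelow_nonneg A n) hnpos.le)]
  have h3 := div_le_div_of_nonneg_right (bound (K+1) (by omega) n) hnpos.le
  rw [add_div, add_div] at h3
  have h4 : (n:ℝ) / ((K+1 : ℕ):ℝ) / n = 1 / ((K:ℝ)+1) := by
    push_cast; field_simp
  rw [h4] at h3
  linarith

/-- Assembling densities over residue classes. -/
lemma dens_residues (A : Set ℕ) (M : ℕ) (hM : 1 ≤ M) (d : ℕ → ℝ)
    (h : ∀ r < M, DensAux {n | M * n + r ∈ A} (d r)) :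
    DensAux A ((∑ r ∈ Finset.range M, d r) / M) := by
  have hMr : (0:ℝ) < M := by exact_mod_cast hM
  have key : ∀ y, cntBelow A (M * y) = ∑ r ∈ Finset.range M, cntBelow {n | M * n + r ∈ A} y := by
    intro y
    induction y with
    | zero => simp [cntBelow]
    | succ y ih =>
      simp_rw [cntBelow_succ, Finset.sum_add_distrib, ← ih]
      unfold cntBelow
      rw [mul_add, mul_one, Finset.sum_range_add]
      rfl
  have hadd : ∀ m k : ℕ, cntBelow A m ≤ cntBelow A (m + k) ∧
      cntBelow A (m + k) ≤ cntBelow A m + k := by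
    intro m k
    unfold cntBelow
    rw [Finset.sum_range_add]
    constructor
    · have := Finset.sum_nonneg (s := Finset.range k) fun i _ => ind_nonneg A (m + i)
      linarith
    · have := Finset.sum_le_sum (s := Finset.range k) fun i _ => ind_le_one A (m + i)
      simp only [Finset.sum_const, Finset.card_range, nsmul_eq_mul, mul_one] at this
      linarith
  have t1 : Tendsto (fun y : ℕ => cntBelow A (M * y) / y) atTop
      (𝓝 (∑ r ∈ Finset.range M, d r)) := by
    have : Tendsto (fun y : ℕ => ∑ r ∈ Finset.range M, cntBelow {n | M * n + r ∈ A} y / y) atTop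
      (𝓝 (∑ r ∈ Finset.range M, d r)) :=
      tendsto_finsetSum _ fun r hr => h r (Finset.mem_range.1 hr)
    refine this.congr fun y => ?_
    rw [key, Finset.sum_div]
  have t2 : Tendsto (fun x : ℕ => x / M) atTop atTop := Nat.tendsto_div_const_atTop (by omega)
  have t3 := t1.comp t2
  have t4 : Tendsto (fun x : ℕ => ((x / M : ℕ) : ℝ) / x) atTop (𝓝 (1 / M)) := by
    have l : Tendsto (fun x : ℕ => (1:ℝ) / M - 1 / x) atTop (𝓝 (1 / M - 0)) :=
      tendsto_const_nhds.sub (tendsto_const_div 1)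
    rw [sub_zero] at l
    refine tendsto_of_tendsto_of_tendsto_of_le_of_le' l tendsto_const_nhds ?_ ?_
    · filter_upwards [eventually_gt_atTop 0] with x hx
      have hx' : (0:ℝ) < x := by exact_mod_cast hx
      have e := Nat.lt_div_mul_add (a := x) (b := M) (by omega)
      have e' : (x:ℝ) < (x / M : ℕ) * M + M := by exact_mod_cast e
      rw [div_sub_div _ _ hMr.ne' hx'.ne', div_le_div_iff₀ (by positivity) hx']
      nlinarith
    · filter_upwards [eventually_gt_atTop 0] with x hx
      have hx' : (0:ℝ) < x := by exact_mod_cast hx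
      have e' : ((x / M : ℕ) : ℝ) * M ≤ x := by exact_mod_cast Nat.div_mul_le_self x M
      rw [div_le_div_iff₀ hx' hMr]
      linarith
  have t5 : Tendsto (fun x : ℕ => cntBelow A (M * (x / M)) / x) atTop
      (𝓝 ((∑ r ∈ Finset.range M, d r) / M)) := by
    have := t3.mul t4
    rw [mul_one_div] at this
    refine this.congr' ?_
    filter_upwards [eventually_ge_atTop M] with x hx
    have hp : 0 < x / M := Nat.div_pos hx (by omega)
    have hp' : ((x / M : ℕ) : ℝ) ≠ 0 := by exact_mod_cast hp.ne'
    simp only [Function.comp]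
    field_simp
  have t6 := t5.add (tendsto_const_div M)
  rw [add_zero] at t6
  refine tendsto_of_tendsto_of_tendsto_of_le_of_le t5 t6 ?_ ?_
  · intro x
    refine div_le_div_of_nonneg_right ?_ (Nat.cast_nonneg x)
    have := (hadd (M * (x / M)) (x % M)).1
    rwa [Nat.div_add_mod] at this
  · intro x
    show _ ≤ cntBelow A (M * (x / M)) / x + (M:ℝ) / x
    rw [← add_div]
    refine div_le_div_of_nonneg_right ?_ (Nat.cast_nonneg x)
    have := (hadd (M * (x / M)) (x % M)).2
    rw [Nat.div_add_mod] at this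
    have e : ((x % M : ℕ) : ℝ) ≤ M := by exact_mod_cast (Nat.mod_lt x (by omega)).le
    linarith

lemma hasNatDensity_of_densAux {A : Set ℕ} {d : ℝ} (h : DensAux A d) : HasNatDensity A d := by
  classical
  have e : ∀ x, ((A ∩ Set.Iic x).ncard : ℝ) = cntBelow A (x+1) := by
    intro x
    have : A ∩ Set.Iic x = ↑((Finset.range (x+1)).filter (· ∈ A)) := by
      ext y; simp [and_comm]
    rw [this, Set.ncard_coe_finset, Finset.card_filter]
    push_cast
    unfold cntBelow
    refine Finset.sum_congr rfl fun i _ => ?_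
    simp [Set.indicator_apply]
  unfold HasNatDensity
  simp_rw [e]
  have t := h.add (tendsto_const_div 1)
  rw [add_zero] at t
  refine tendsto_of_tendsto_of_tendsto_of_le_of_le h t ?_ ?_
  · intro x
    refine div_le_div_of_nonneg_right ?_ (Nat.cast_nonneg x)
    rw [cntBelow_succ]; linarith [ind_nonneg A x]
  · intro x
    show _ ≤ cntBelow A x / x + (1:ℝ) / x
    rw [← add_div]
    refine div_le_div_of_nonneg_right ?_ (Nat.cast_nonneg x)
    rw [cntBelow_succ]; linarith [ind_le_one A x]

/-- The shift operator on complex sequences. -/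
def shiftOp : Module.End ℂ (ℕ → ℂ) := LinearMap.funLeft ℂ ℂ Nat.succ

lemma shiftOp_apply (g : ℕ → ℂ) (n : ℕ) : shiftOp g n = g (n+1) := rfl

lemma shiftOp_pow_apply (k : ℕ) (g : ℕ → ℂ) (n : ℕ) : (shiftOp ^ k) g n = g (n+k) := by
  induction k generalizing n with
  | zero => rfl
  | succ k ih =>
    rw [pow_succ', Module.End.mul_apply, shiftOp_apply, ih]
    congr 1; omega

lemma aeval_linear_apply (a : ℂ) (g : ℕ → ℂ) (n : ℕ) :
    aeval shiftOp (X - C a) g n = g (n+1) - a * g n := by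
  simp [shiftOp_apply, Algebra.algebraMap_eq_smul_one]

lemma aeval_pow_sub_apply (a : ℂ) (h : ℕ) (g : ℕ → ℂ) (n : ℕ) :
    aeval shiftOp (X ^ h - C a) g n = g (n+h) - a * g n := by
  simp [shiftOp_pow_apply, Algebra.algebraMap_eq_smul_one]

lemma aeval_mul_app (p q : ℂ[X]) (g : ℕ → ℂ) :
    aeval shiftOp (p * q) g = aeval shiftOp p (aeval shiftOp q g) := by
  rw [map_mul, Module.End.mul_apply]

lemma eq_zero_of_coprime {p q : ℂ[X]} (h : IsCoprime p q) {v : ℕ → ℂ}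
    (hp : aeval shiftOp p v = 0) (hq : aeval shiftOp q v = 0) : v = 0 := by
  obtain ⟨a, b, hab⟩ := h
  have : aeval shiftOp (a * p + b * q) v = v := by rw [hab]; simp
  rw [← this, map_add, LinearMap.add_apply, aeval_mul_app, aeval_mul_app, hp, hq]
  simp

lemma geom_factor (a : ℂ) (h : ℕ) (hh : 1 ≤ h) (ha : a ≠ 0) :
    ∃ Q : ℂ[X], (X ^ h - C (a ^ h)) = Q * (X - C a) ∧
      ∀ b : ℂ, (a ^ h = b ^ h → a = b) → IsCoprime (X - C b) Q := by
  refine ⟨∑ i ∈ Finset.range h, X ^ i * (C a) ^ (h - 1 - i), ?_, ?_⟩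
  · rw [geom_sum₂_mul, C_pow]
  · intro b hb
    rw [(irreducible_X_sub_C b).coprime_iff_not_dvd, dvd_iff_isRoot, IsRoot.def]
    simp only [eval_finsetSum, eval_mul, eval_pow, eval_X, eval_C]
    intro h0
    have h1 := geom_sum₂_mul b a h
    rw [h0, zero_mul] at h1
    obtain rfl := hb (sub_eq_zero.1 h1.symm).symm
    have h2 : ∑ i ∈ Finset.range h, a ^ i * a ^ (h - 1 - i) = h * a ^ (h-1) := by
      rw [Finset.sum_congr rfl (g := fun _ => a ^ (h-1))]
      · simp
      · intro i hi
        rw [← pow_add]; congr 1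
        have := Finset.mem_range.1 hi
        omega
    rw [h2] at h0
    have : (h:ℂ) ≠ 0 := by exact_mod_cast (by omega : h ≠ 0)
    exact mul_ne_zero this (pow_ne_zero _ ha) h0

/-- The nondegenerate case: zeros have density zero unless the sequence vanishes eventually. -/
lemma nondegenerate_zeros (l : List ℂ)
    (hl : ∀ a ∈ l, ∀ b ∈ l, ∀ h : ℕ, 1 ≤ h → a ^ h = b ^ h → a = b) (g : ℕ → ℂ)
    (hg : aeval shiftOp (l.map fun a => X - C a).prod g = 0) :
    (∃ k, ∀ n, g (n + k) = 0) ∨ DensAux {n | g n = 0} 0 := by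
  induction l generalizing g with
  | nil =>
    left
    refine ⟨0, fun n => ?_⟩
    have : g = 0 := by simpa using hg
    rw [this]; rfl
  | cons a l ih =>
    have ih' := ih (fun a ha b hb => hl a (List.mem_cons_of_mem _ ha) b (List.mem_cons_of_mem _ hb))
    rw [List.map_cons, List.prod_cons] at hg
    by_cases ha : a = 0
    · subst ha
      rw [mul_comm, aeval_mul_app] at hg
      have e : ∀ n, aeval shiftOp (X - C (0:ℂ)) g n = g (n+1) := by
        intro n; rw [aeval_linear_apply]; ring
      rcases ih' _ hg with ⟨k, hk⟩ | hd
      · left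
        refine ⟨k+1, fun n => ?_⟩
        rw [← add_assoc, ← e]; exact hk n
      · right
        refine densZero_shift ?_
        simp only [e] at hd
        exact hd
    · by_cases hall : ∀ h, 1 ≤ h → DensAux {n | aeval shiftOp (X ^ h - C (a ^ h)) g n = 0} 0
      · right
        refine densZero_of_shifts fun h hh => ?_
        refine densZero_mono (hall h hh) ?_
        rintro n ⟨h1, h2⟩
        simp only [Set.mem_ofPred_eq] at h1 h2 ⊢
        rw [aeval_pow_sub_apply, h1, h2]; ring
      · push Not at hall
        obtain ⟨h, hh, hnd⟩ := hall
        obtain ⟨Q, hQ, hcop⟩ := geom_factor a h hh ha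
        have hu : aeval shiftOp (l.map fun a => X - C a).prod
            (aeval shiftOp (X ^ h - C (a ^ h)) g) = 0 := by
          rw [← aeval_mul_app, hQ, show (l.map fun a => X - C a).prod * (Q * (X - C a)) =
            Q * ((X - C a) * (l.map fun a => X - C a).prod) by ring, aeval_mul_app, hg, map_zero]
        obtain ⟨k, hk⟩ := (ih' _ hu).resolve_right hnd
        have hcop' : IsCoprime ((a :: l).map fun a => X - C a).prod Q := by
          have : ∀ m : List ℂ, (∀ b ∈ m, b ∈ a :: l) →
              IsCoprime (m.map fun a => X - C a).prod Q := by
            intro m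
            induction m with
            | nil => intro _; simpa using isCoprime_one_left
            | cons b m ihm =>
              intro hm
              rw [List.map_cons, List.prod_cons]
              refine IsCoprime.mul_left (hcop b ?_) (ihm fun c hc => hm c (List.mem_cons_of_mem _ hc))
              exact hl a List.mem_cons_self b (hm b List.mem_cons_self) h hh
          exact this _ fun b hb => hb
        have hv : aeval shiftOp (X ^ k * (X - C a)) g = 0 := by
          refine eq_zero_of_coprime hcop' ?_ ?_
          · rw [List.map_cons, List.prod_cons, ← aeval_mul_app, mul_comm, aeval_mul_app, hg, map_zero]
          · rw [← aeval_mul_app, mul_left_comm, ← hQ, aeval_mul_app]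
            funext n
            rw [map_pow, aeval_X, shiftOp_pow_apply]
            exact hk n
        have hrec : ∀ n, g (n + k + 1) = a * g (n + k) := by
          intro n
          have := congrFun hv n
          rw [aeval_mul_app, map_pow, aeval_X, shiftOp_pow_apply, aeval_linear_apply] at this
          exact sub_eq_zero.1 this
        have hgeo : ∀ n, g (n + k) = a ^ n * g k := by
          intro n
          induction n with
          | zero => simp
          | succ n ihn => rw [add_right_comm, hrec, ihn]; ring
        by_cases h0 : g k = 0
        · left
          exact ⟨k, fun n => by rw [hgeo, h0, mul_zero]⟩
        · right
          refine densZero_shift_iter k ?_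
          refine densZero_mono densZero_empty ?_
          intro n hn
          simp only [Set.mem_ofPred_eq] at hn
          rw [hgeo] at hn
          exact absurd hn (mul_ne_zero (pow_ne_zero _ ha) h0)

lemma exists_modulus (L : List (ℂ × ℂ)) :
    ∃ M : ℕ, 1 ≤ M ∧ ∀ p ∈ L, (∃ h : ℕ, 1 ≤ h ∧ p.1 ^ h = p.2 ^ h) → p.1 ^ M = p.2 ^ M := by
  induction L with
  | nil => exact ⟨1, le_rfl, by simp⟩
  | cons q L ih =>
    obtain ⟨M, hM, h⟩ := ih
    by_cases hq : ∃ h : ℕ, 1 ≤ h ∧ q.1 ^ h = q.2 ^ h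
    · obtain ⟨k, hk, e⟩ := hq
      refine ⟨M * k, Nat.mul_pos hM hk, ?_⟩
      intro p hp hex
      rcases List.mem_cons.1 hp with rfl | hp
      · rw [mul_comm, pow_mul, pow_mul, e]
      · rw [pow_mul, pow_mul, h p hp hex]
    · refine ⟨M, hM, ?_⟩
      intro p hp hex
      rcases List.mem_cons.1 hp with rfl | hp
      · exact absurd hex hq
      · exact h p hp hex

/-- Restriction to a residue class intertwines `shiftOp ^ M` and `shiftOp`. -/
lemma aeval_residue (M r : ℕ) (q : ℂ[X]) (f : ℕ → ℂ) (n : ℕ) :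
    aeval shiftOp q (fun m => f (M * m + r)) n = aeval (shiftOp ^ M) q f (M * n + r) := by
  induction q using Polynomial.induction_on' with
  | add p q hp hq => simp only [map_add, LinearMap.add_apply, Pi.add_apply, hp, hq]
  | monomial k c =>
    simp only [aeval_monomial, Module.End.mul_apply, Algebra.algebraMap_eq_smul_one,
      LinearMap.smul_apply, Module.End.one_apply, Pi.smul_apply, ← pow_mul, shiftOp_pow_apply]
    congr 2; ring

lemma prod_dvd_expand (M : ℕ) (l : List ℂ) :
    (l.map fun a => X - C a).prod ∣
      expand ℂ M ((l.map fun a => a ^ M).map fun a => X - C a).prod := by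
  induction l with
  | nil => simp
  | cons a l ih =>
    simp only [List.map_cons, List.prod_cons, map_mul]
    refine mul_dvd_mul ?_ ih
    rw [map_sub, expand_X, expand_C, C_pow]
    exact sub_dvd_pow_sub_pow _ _ M

lemma exists_roots_list (f : ℕ → ℝ) (hf : IsLinearRecurrence f) :
    ∃ l : List ℂ, aeval shiftOp (l.map fun a => X - C a).prod (fun n => (f n : ℂ)) = 0 := by
  obtain ⟨h, _, c, hc⟩ := hf
  set g : ℕ → ℂ := fun n => (f n : ℂ) with hgdef
  let p : ℂ[X] := X ^ h - ∑ i : Fin h, C (c i : ℂ) * X ^ (i : ℕ)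
  have hp : p.Monic := monic_X_pow_sub (degree_sum_fin_lt _)
  have hpg : aeval shiftOp p g = 0 := by
    funext n
    have := congrArg (fun x : ℝ => (x : ℂ)) (hc n)
    simp only [p, map_sub, map_sum, map_mul, map_pow, aeval_X, aeval_C, LinearMap.sub_apply,
      Pi.sub_apply, LinearMap.sum_apply, Finset.sum_apply, Module.End.mul_apply,
      Algebra.algebraMap_eq_smul_one, LinearMap.smul_apply, Module.End.one_apply, Pi.smul_apply,
      shiftOp_pow_apply, smul_eq_mul, Pi.zero_apply, hgdef]
    rw [this]
    push_cast
    ring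
  have hs := (IsAlgClosed.splits p).eq_prod_roots_of_monic hp
  refine ⟨p.roots.toList, ?_⟩
  have e : (p.roots.toList.map fun a => X - C a).prod = p := by
    conv_rhs => rw [hs]
    conv_rhs => rw [← Multiset.coe_toList p.roots]
    rw [Multiset.map_coe, Multiset.prod_coe]
  rw [e, hpg]

end

theorem density_of_zero_set_exists_and_is_rational
    (f : ℕ → ℝ) (hf : IsLinearRecurrence f) :
    ∃ δ : ℚ, HasNatDensity {n : ℕ | f n = 0} (δ : ℝ) := by
  obtain ⟨l, hl⟩ := exists_roots_list f hf
  obtain ⟨M, hM, hMp⟩ := exists_modulus (l.product l)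
  have hnd : ∀ a ∈ l.map (fun a => a ^ M), ∀ b ∈ l.map (fun a => a ^ M),
      ∀ h : ℕ, 1 ≤ h → a ^ h = b ^ h → a = b := by
    intro a ha b hb h hh e
    obtain ⟨a, ha', rfl⟩ := List.mem_map.1 ha
    obtain ⟨b, hb', rfl⟩ := List.mem_map.1 hb
    refine hMp (a, b) (List.mem_product.2 ⟨ha', hb'⟩) ⟨M * h, Nat.mul_pos hM hh, ?_⟩
    simpa [pow_mul] using e
  have hres : ∀ r, ∃ d : ℚ, DensAux {n | M * n + r ∈ {n : ℕ | f n = 0}} (d : ℝ) := by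
    intro r
    have h0 : aeval shiftOp ((l.map fun a => a ^ M).map fun a => X - C a).prod
        (fun m => (f (M * m + r) : ℂ)) = 0 := by
      funext n
      rw [aeval_residue M r _ (fun n => (f n : ℂ)), ← expand_aeval]
      obtain ⟨q, hq⟩ := prod_dvd_expand M l
      rw [hq, mul_comm, aeval_mul_app, hl, map_zero]
      rfl
    rcases nondegenerate_zeros _ hnd _ h0 with ⟨k, hk⟩ | hd
    · refine ⟨1, ?_⟩
      rw [Rat.cast_one]
      refine dens_one k fun n => ?_
      have := hk n
      exact_mod_cast this
    · refine ⟨0, ?_⟩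
      rw [Rat.cast_zero]
      refine densZero_mono hd ?_
      intro n hn
      have hn' : f (M * n + r) = 0 := hn
      simp [hn']
  choose d hd using hres
  refine ⟨(∑ r ∈ Finset.range M, d r) / M, ?_⟩
  have := hasNatDensity_of_densAux (dens_residues _ M hM (fun r => (d r : ℝ)) fun r _ => hd r)
  push_cast
  exact this
end

section
/- Let w be a real number and define f_n := sin(2π n √2) − w for n ∈ ℕ. Then the natural density of {n ∈ ℕ : f_n > 0} exists and equals 1 if w ≤ −1, equals 1/2 − (1/π)·arcsin(w) if −1 ≤ w ≤ 1, and equals 0 if w ≥ 1. -/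
open Real

open MeasureTheory Filter Topology AddCircle

noncomputable section Helpers

instance factTwoPi : Fact (0 < 2 * π) := ⟨Real.two_pi_pos⟩

/-- The empirical measure of the first `N+1` multiples of `a`. -/
def empM (a : AddCircle (2 * π)) (N : ℕ) : Measure (AddCircle (2 * π)) :=
  ((N + 1 : ℕ) : ENNReal)⁻¹ • ∑ n ∈ Finset.range (N + 1), Measure.dirac (n • a)

instance empM_prob (a : AddCircle (2 * π)) (N : ℕ) : IsProbabilityMeasure (empM a N) := by
  constructor
  rw [empM, Measure.smul_apply, Measure.finsetSum_apply]
  simp only [measure_univ, Finset.sum_const, Finset.card_range, smul_eq_mul, nsmul_eq_mul, mul_one]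
  exact ENNReal.inv_mul_cancel (by simp) (by simp)

theorem empM_integral (a : AddCircle (2 * π)) (N : ℕ) (f : AddCircle (2 * π) → ℂ) :
    ∫ x, f x ∂(empM a N) = ((N : ℂ) + 1)⁻¹ * ∑ n ∈ Finset.range (N + 1), f (n • a) := by
  rw [empM, integral_smul_measure, integral_finsetSum_measure]
  · simp only [integral_dirac]
    rw [ENNReal.toReal_inv, ENNReal.toReal_natCast, Complex.real_smul]
    push_cast
    rfl
  · intro i _
    exact integrable_dirac (by simp)

theorem weyl_fourier (a : AddCircle (2 * π)) (ha : ∀ k : ℤ, k ≠ 0 → k • a ≠ 0) (k : ℤ) :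
    Tendsto (fun N => ∫ x, fourier k x ∂(empM a N)) atTop
      (𝓝 (∫ x, fourier k x ∂(haarAddCircle (T := 2 * π)))) := by
  by_cases hk : k = 0
  · subst hk
    simp
  set c : ℂ := fourier k a with hc
  have hc1 : c ≠ 1 := by
    intro h
    rw [hc, fourier_apply] at h
    have h2 : toCircle (k • a) = toCircle (0 : AddCircle (2 * π)) := by
      rw [toCircle_zero]
      exact Circle.ext (by simpa using h)
    exact ha k hk (injective_toCircle Real.two_pi_pos.ne' h2)
  have hadd : ∀ x y : AddCircle (2 * π), fourier k (x + y) = (fourier k x : ℂ) * fourier k y := by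
    intro x y
    simp only [fourier_apply, smul_add, toCircle_add, Circle.coe_mul]
  have hpow : ∀ n : ℕ, fourier k (n • a) = c ^ n := by
    intro n
    induction n with
    | zero => simp
    | succ n ih => rw [succ_nsmul, hadd, ih, pow_succ]
  have hnorm : ‖c‖ = 1 := by
    rw [hc, fourier_apply]; exact Circle.norm_coe _
  have hint : ∫ x, fourier k x ∂(haarAddCircle (T := 2 * π)) = 0 := by
    have h1 := integral_add_right_eq_self (μ := haarAddCircle (T := 2 * π))
      (fun x => (fourier k x : ℂ)) a
    simp only [hadd] at h1
    rw [integral_mul_const] at h1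
    have h2 : (∫ x, fourier k x ∂(haarAddCircle (T := 2 * π))) * (c - 1) = 0 := by
      rw [mul_sub, h1]; ring
    rcases mul_eq_zero.1 h2 with h | h
    · exact h
    · exact absurd (sub_eq_zero.1 h) hc1
  rw [hint]
  simp only [empM_integral, hpow, geom_sum_eq hc1]
  have hlim : Tendsto (fun N : ℕ => (1 / ((N : ℝ) + 1)) * (2 / ‖c - 1‖)) atTop (𝓝 0) := by
    simpa using (tendsto_one_div_add_atTop_nhds_zero_nat (𝕜 := ℝ)).mul_const (2 / ‖c - 1‖)
  refine squeeze_zero_norm (fun N => ?_) hlim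
  rw [norm_mul, norm_div, norm_inv, one_div]
  have : ‖(N : ℂ) + 1‖ = (N : ℝ) + 1 := by
    have := Complex.norm_natCast (N + 1)
    push_cast at this
    exact this
  rw [this]
  gcongr
  calc ‖c ^ (N + 1) - 1‖ ≤ ‖c ^ (N + 1)‖ + ‖(1 : ℂ)‖ := norm_sub_le _ _
    _ = 2 := by rw [norm_pow, hnorm]; norm_num

theorem cont_integrable (μ : Measure (AddCircle (2 * π))) [IsProbabilityMeasure μ]
    (f : C(AddCircle (2 * π), ℂ)) : Integrable (fun x => f x) μ :=
  f.continuous.integrable_of_hasCompactSupport (HasCompactSupport.of_compactSpace _)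

theorem int_close (μ : Measure (AddCircle (2 * π))) [IsProbabilityMeasure μ]
    (f g : C(AddCircle (2 * π), ℂ)) : ‖∫ x, f x ∂μ - ∫ x, g x ∂μ‖ ≤ ‖f - g‖ := by
  rw [← integral_sub (cont_integrable μ f) (cont_integrable μ g)]
  have := norm_integral_le_of_norm_le_const (μ := μ) (f := fun x => f x - g x) (C := ‖f - g‖)
    (Eventually.of_forall fun x => (f - g).norm_coe_le_norm x)
  simpa using this

theorem weyl_cont (a : AddCircle (2 * π)) (ha : ∀ k : ℤ, k ≠ 0 → k • a ≠ 0)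
    (f : C(AddCircle (2 * π), ℂ)) :
    Tendsto (fun N => ∫ x, f x ∂(empM a N)) atTop
      (𝓝 (∫ x, f x ∂(haarAddCircle (T := 2 * π)))) := by
  have hspan : ∀ g ∈ Submodule.span ℂ (Set.range (@fourier (2 * π))),
      Tendsto (fun N => ∫ x, g x ∂(empM a N)) atTop
      (𝓝 (∫ x, g x ∂(haarAddCircle (T := 2 * π)))) := by
    intro g hg
    induction hg using Submodule.span_induction with
    | mem x h => obtain ⟨k, rfl⟩ := h; exact weyl_fourier a ha k
    | zero => simp
    | add x y _ _ hx hy =>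
      simp only [ContinuousMap.add_apply]
      rw [integral_add (cont_integrable _ x) (cont_integrable _ y)]
      refine (hx.add hy).congr fun N => ?_
      rw [integral_add (cont_integrable _ x) (cont_integrable _ y)]
    | smul c x _ hx =>
      simp only [ContinuousMap.smul_apply, integral_smul]
      exact hx.const_smul c
  have hf : f ∈ (Submodule.span ℂ (Set.range (@fourier (2 * π)))).topologicalClosure := by
    rw [span_fourier_closure_eq_top]; trivial
  have hf' : f ∈ closure (Submodule.span ℂ (Set.range (@fourier (2 * π))) : Set _) := hf
  rw [Metric.mem_closure_iff] at hf'
  rw [Metric.tendsto_atTop]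
  intro ε hε
  obtain ⟨g, hg, hfg⟩ := hf' (ε / 3) (by positivity)
  obtain ⟨N₀, hN₀⟩ := Metric.tendsto_atTop.1 (hspan g hg) (ε / 3) (by positivity)
  refine ⟨N₀, fun N hN => ?_⟩
  have h1 := int_close (empM a N) f g
  have h2 := int_close (haarAddCircle (T := 2 * π)) f g
  have h3 := hN₀ N hN
  rw [← dist_eq_norm, ← dist_eq_norm] at h1 h2
  rw [dist_comm] at h2
  have h4 := dist_triangle4 (∫ x, f x ∂(empM a N)) (∫ x, g x ∂(empM a N))
    (∫ x, g x ∂(haarAddCircle (T := 2 * π))) (∫ x, f x ∂(haarAddCircle (T := 2 * π)))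
  linarith

theorem weyl_set (a : AddCircle (2 * π)) (ha : ∀ k : ℤ, k ≠ 0 → k • a ≠ 0)
    (S : Set (AddCircle (2 * π))) (hS : haarAddCircle (frontier S) = 0) :
    Tendsto (fun N => empM a N S) atTop (𝓝 (haarAddCircle S)) := by
  let P : ℕ → ProbabilityMeasure (AddCircle (2 * π)) := fun N => ⟨empM a N, inferInstance⟩
  let Q : ProbabilityMeasure (AddCircle (2 * π)) := ⟨haarAddCircle, inferInstance⟩
  have key : Tendsto P atTop (𝓝 Q) := by
    rw [ProbabilityMeasure.tendsto_iff_forall_integral_rclike_tendsto ℂ]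
    intro f
    exact weyl_cont a ha f.toContinuousMap
  exact ProbabilityMeasure.tendsto_measure_of_null_frontier_of_tendsto' key hS

/-- Sine on the circle. -/
def csin : AddCircle (2 * π) → ℝ := Real.sin_periodic.lift

theorem csin_coe (x : ℝ) : csin (x : AddCircle (2 * π)) = Real.sin x := rfl

theorem csin_cont : Continuous csin :=
  continuous_coinduced_dom.2 Real.continuous_sin

theorem haar_set (S : Set (AddCircle (2 * π))) (hS : MeasurableSet S) :
    haarAddCircle S = (ENNReal.ofReal (2 * π))⁻¹ *
      volume ((fun x : ℝ => (x : AddCircle (2 * π))) ⁻¹' S ∩ Set.Ioc (-(π / 2)) (-(π / 2) + 2 * π)) := by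
  have h1 := add_projection_respects_measure (T := 2 * π) (-(π / 2)) hS
  have h2 : (volume : Measure (AddCircle (2 * π))) S
      = ENNReal.ofReal (2 * π) * haarAddCircle S := by
    rw [volume_eq_smul_haarAddCircle]; rfl
  have h3 : volume S = volume ((fun x : ℝ => (x : AddCircle (2 * π))) ⁻¹' S ∩
      Set.Ioc (-(π / 2)) (-(π / 2) + 2 * π)) := h1
  rw [← h3, h2, ← mul_assoc, ENNReal.inv_mul_cancel, one_mul]
  · simp [Real.pi_pos]
  · exact ENNReal.ofReal_ne_top

theorem haar_eq_null (w : ℝ) : haarAddCircle {x : AddCircle (2 * π) | w = csin x} = 0 := by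
  rw [haar_set _ (isClosed_eq continuous_const csin_cont).measurableSet]
  have : ((fun x : ℝ => (x : AddCircle (2 * π))) ⁻¹' {x | w = csin x} ∩
      Set.Ioc (-(π / 2)) (-(π / 2) + 2 * π)) ⊆ {Real.arcsin w, π - Real.arcsin w} := by
    rintro x ⟨hx, h1, h2⟩
    have hx : w = Real.sin x := hx
    subst hx
    by_cases h : x ≤ π / 2
    · left; rw [Real.arcsin_sin h1.le h]
    · right
      have : Real.arcsin (Real.sin (π - x)) = π - x := Real.arcsin_sin (by linarith) (by linarith)
      rw [Real.sin_pi_sub] at this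
      simp [this]
  rw [measure_mono_null this ((Set.toFinite _).measure_zero _), mul_zero]

theorem haar_gt (w : ℝ) (h1 : -1 ≤ w) (h2 : w ≤ 1) :
    haarAddCircle {x : AddCircle (2 * π) | w < csin x}
      = ENNReal.ofReal (1 / 2 - Real.arcsin w / π) := by
  rw [haar_set _ (isOpen_lt continuous_const csin_cont).measurableSet]
  have : ((fun x : ℝ => (x : AddCircle (2 * π))) ⁻¹' {x | w < csin x} ∩
      Set.Ioc (-(π / 2)) (-(π / 2) + 2 * π)) = Set.Ioo (Real.arcsin w) (π - Real.arcsin w) := by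
    have hl := Real.neg_pi_div_two_le_arcsin w
    have hu := Real.arcsin_le_pi_div_two w
    ext x
    constructor
    · rintro ⟨hx, h3, h4⟩
      have hx : w < Real.sin x := hx
      by_cases h : x ≤ π / 2
      · have := (Real.arcsin_lt_iff_lt_sin ⟨h1, h2⟩ ⟨h3.le, h⟩).2 hx
        refine ⟨this, by linarith⟩
      · rw [← Real.sin_pi_sub] at hx
        have := (Real.arcsin_lt_iff_lt_sin ⟨h1, h2⟩ ⟨by linarith, by linarith⟩).2 hx
        refine ⟨by linarith, by linarith⟩
    · rintro ⟨h3, h4⟩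
      refine ⟨?_, by linarith, by linarith⟩
      change w < Real.sin x
      by_cases h : x ≤ π / 2
      · exact (Real.arcsin_lt_iff_lt_sin ⟨h1, h2⟩ ⟨by linarith, h⟩).1 h3
      · rw [← Real.sin_pi_sub]
        exact (Real.arcsin_lt_iff_lt_sin ⟨h1, h2⟩ ⟨by linarith, by linarith⟩).1 (by linarith)
  rw [this, Real.volume_Ioo, ← ENNReal.ofReal_inv_of_pos Real.two_pi_pos,
    ← ENNReal.ofReal_mul (by positivity)]
  congr 1
  have := Real.pi_pos.ne'
  field_simp
  ring

theorem irr_mult (k : ℤ) (hk : k ≠ 0) :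
    k • ((2 * π * Real.sqrt 2 : ℝ) : AddCircle (2 * π)) ≠ 0 := by
  intro h
  rw [← AddCircle.coe_zsmul, AddCircle.coe_eq_zero_iff] at h
  obtain ⟨m, hm⟩ := h
  simp only [zsmul_eq_mul] at hm
  have h2 : (m : ℝ) = k * Real.sqrt 2 := by
    have := Real.two_pi_pos.ne'
    apply mul_right_cancel₀ this
    rw [hm]; ring
  exact (irrational_sqrt_two.intCast_mul hk).ne_int m h2.symm

theorem empM_count (w : ℝ) (f : ℕ → ℝ)
    (hf : ∀ n : ℕ, f n = Real.sin (2 * π * n * Real.sqrt 2) - w) (N : ℕ) :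
    (empM ((2 * π * Real.sqrt 2 : ℝ) : AddCircle (2 * π)) N {x | w < csin x}).toReal
      = (({n : ℕ | 0 < f n} ∩ Set.Iic N).ncard : ℝ) / (N + 1) := by
  classical
  have hmem : ∀ n : ℕ, n • ((2 * π * Real.sqrt 2 : ℝ) : AddCircle (2 * π)) ∈ {x | w < csin x}
      ↔ 0 < f n := by
    intro n
    rw [← AddCircle.coe_nsmul, Set.mem_ofPred_eq, csin_coe, hf, nsmul_eq_mul, sub_pos,
      show (n : ℝ) * (2 * π * Real.sqrt 2) = 2 * π * n * Real.sqrt 2 by ring]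
  have hset : {n : ℕ | 0 < f n} ∩ Set.Iic N
      = ((Finset.range (N + 1)).filter (fun n => 0 < f n) : Finset ℕ) := by
    ext n
    simp [and_comm]
  rw [hset, Set.ncard_coe_finset, empM, Measure.smul_apply, Measure.finsetSum_apply]
  simp only [Measure.dirac_apply' _ (isOpen_lt continuous_const csin_cont).measurableSet,
    Set.indicator_apply, hmem, Pi.one_apply, Finset.sum_boole, smul_eq_mul, ENNReal.toReal_mul,
    ENNReal.toReal_inv, ENNReal.toReal_natCast]
  push_cast
  rw [div_eq_inv_mul]

theorem dens_general (w : ℝ) (f : ℕ → ℝ)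
    (hf : ∀ n : ℕ, f n = Real.sin (2 * π * n * Real.sqrt 2) - w) :
    HasNatDensity {n : ℕ | 0 < f n}
      (haarAddCircle {x : AddCircle (2 * π) | w < csin x}).toReal := by
  have hfr : haarAddCircle (frontier {x : AddCircle (2 * π) | w < csin x}) = 0 :=
    measure_mono_null (frontier_lt_subset_eq continuous_const csin_cont) (haar_eq_null w)
  have h := (ENNReal.tendsto_toReal (measure_ne_top _ _)).comp (weyl_set _ irr_mult _ hfr)
  have h2 : Tendsto (fun N : ℕ => 1 + 1 / (N : ℝ)) atTop (𝓝 (1 + 0)) :=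
    tendsto_const_nhds.add tendsto_one_div_atTop_nhds_zero_nat
  have h3 := h.mul h2
  rw [add_zero, mul_one] at h3
  refine h3.congr' ?_
  filter_upwards [eventually_gt_atTop 0] with N hN
  have hN' : (N : ℝ) ≠ 0 := by positivity
  have hN2 : (N : ℝ) + 1 ≠ 0 := by positivity
  simp only [Function.comp, empM_count w f hf N]
  field_simp

end Helpers

theorem density_of_shifted_sine_sequence
    (w : ℝ) (f : ℕ → ℝ)
    (hf : ∀ n : ℕ, f n = Real.sin (2 * π * n * Real.sqrt 2) - w) :
    (w ≤ -1 → HasNatDensity {n : ℕ | 0 < f n} 1) ∧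
    (-1 ≤ w → w ≤ 1 →
      HasNatDensity {n : ℕ | 0 < f n} (1 / 2 - Real.arcsin w / π)) ∧
    (1 ≤ w → HasNatDensity {n : ℕ | 0 < f n} 0) := by
  have hgen := dens_general w f hf
  have hmid : -1 ≤ w → w ≤ 1 →
      HasNatDensity {n : ℕ | 0 < f n} (1 / 2 - Real.arcsin w / π) := by
    intro h1 h2
    rw [haar_gt w h1 h2, ENNReal.toReal_ofReal] at hgen
    · exact hgen
    · rw [sub_nonneg, div_le_iff₀ Real.pi_pos]
      have := Real.arcsin_le_pi_div_two w
      linarith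
  refine ⟨fun h => ?_, hmid, fun h => ?_⟩
  · rcases h.lt_or_eq with h | h
    · have : {x : AddCircle (2 * π) | w < csin x} = Set.univ := by
        ext x
        induction x using QuotientAddGroup.induction_on with
        | H x => simpa [csin_coe] using h.trans_le (Real.neg_one_le_sin x)
      rw [this] at hgen
      simpa using hgen
    · have := hmid h.ge (by linarith)
      have h0 : (1 / 2 - Real.arcsin w / π) = 1 := by
        rw [h, Real.arcsin_neg_one]
        have := Real.pi_pos.ne'
        field_simp
        norm_num
      rwa [h0] at this
  · have : {x : AddCircle (2 * π) | w < csin x} = ∅ := by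
      ext x
      induction x using QuotientAddGroup.induction_on with
      | H x => simpa [csin_coe] using (Real.sin_le_one x).trans h
    rw [this] at hgen
    simpa using hgen
end
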